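/- arXiv:0902.1729 — 6 statements merged into one kernel-verified Lean document; each statement's English description precedes it below -/
import Mathlib

section
/- Let p be a prime, q = p^r with r ≥ 1, m ≥ 2, and let k ≥ 0 be an integer. Let K = { f ∈ 𝔽_{q^m}[z] : deg f ≤ k and Tr(f(x)) = 0 for all x ∈ 𝔽_{q^m} } and E = { h^q − h : h ∈ 𝔽_{q^m}[z], deg h ≤ ⌊k/q⌋ }. If K ≠ E, then there exists f ∈ K \ E such that f ≠ h^p − h for every h ∈ 𝔽̄(z), where 𝔽̄ is an algebraic closure of 𝔽_{q^m} and 𝔽_{q^m}[z] ⊆ 𝔽̄(z). -/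
open Polynomial

/-- The natural embedding `RatFunc K →+* RatFunc L` induced by a field embedding `K →+* L`. -/
noncomputable def ratFuncMap {K L : Type} [Field K] [Field L] (φ : K →+* L) :
    RatFunc K →+* RatFunc L :=
  RatFunc.mapRingHom (Polynomial.mapRingHom φ) (by
    intro q hq
    simp only [Submonoid.mem_comap, coe_mapRingHom]
    rw [mem_nonZeroDivisors_iff_ne_zero] at hq ⊢
    exact (Polynomial.map_ne_zero_iff φ.injective).mpr hq)

theorem aux_coeff {L : Type} [Field L] (p : ℕ) [Fact p.Prime] [CharP L p] (H g : L[X])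
    (hg : H ^ p - H = g) (n : ℕ) (hn : ¬ p ∣ n) (j : ℕ) (hj : g.natDegree ≤ n * p ^ j) :
    ∑ i ∈ Finset.range (j + 1), (g.coeff (n * p ^ i)) ^ p ^ (j - i) = 0 := by
  have hp : p.Prime := Fact.out
  have hn0 : 0 < n := Nat.pos_of_ne_zero (by rintro rfl; simp at hn)
  have hc1 : ∀ a, (H ^ p).coeff (a * p) = (H.coeff a) ^ p := by
    intro a
    rw [← map_frobenius_expand, coeff_map, coeff_expand_mul hp.pos, frobenius_def]
  have hc2 : (H ^ p).coeff n = 0 := by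
    rw [← map_frobenius_expand, coeff_map, coeff_expand hp.pos, if_neg hn, map_zero]
  have key : ∀ j, ∑ i ∈ Finset.range (j + 1), (g.coeff (n * p ^ i)) ^ p ^ (j - i)
      = - H.coeff (n * p ^ j) := by
    intro j
    induction j with
    | zero => simp [← hg, hc2]
    | succ j ih =>
      rw [Finset.sum_range_succ]
      have : ∑ i ∈ Finset.range (j + 1), (g.coeff (n * p ^ i)) ^ p ^ (j + 1 - i)
          = frobenius L p (∑ i ∈ Finset.range (j + 1), (g.coeff (n * p ^ i)) ^ p ^ (j - i)) := by
        rw [map_sum]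
        refine Finset.sum_congr rfl fun i hi => ?_
        have : i ≤ j := by simpa [Nat.lt_succ_iff] using hi
        rw [frobenius_def, ← pow_mul, ← pow_succ]
        congr 2
        omega
      rw [this, ih, map_neg, frobenius_def]
      simp only [Nat.sub_self, pow_zero, pow_one]
      conv_lhs => rw [← hg]
      rw [coeff_sub, pow_succ, ← mul_assoc, hc1]
      ring
  rw [key j, neg_eq_zero]
  apply coeff_eq_zero_of_natDegree_lt
  rcases Nat.eq_zero_or_pos H.natDegree with h0 | h0
  · rw [h0]; exact Nat.mul_pos hn0 (pow_pos hp.pos _)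
  · have hlt : H.natDegree < (H ^ p).natDegree := by
      rw [natDegree_pow]; nlinarith [hp.two_le]
    have := natDegree_sub_eq_left_of_natDegree_lt hlt
    rw [hg] at this
    omega

theorem aux_poly {L : Type} [Field L] (p : ℕ) (hp : p.Prime) (g : L[X]) (h : RatFunc L)
    (hh : algebraMap L[X] (RatFunc L) g = h ^ p - h) : ∃ H : L[X], H ^ p - H = g := by
  have hint : IsIntegral L[X] h := by
    refine ⟨X ^ p - (X + C g), ?_, ?_⟩
    · apply monic_X_pow_sub
      rw [degree_X_add_C]
      exact_mod_cast hp.one_lt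
    · simp [hh]
  obtain ⟨H, rfl⟩ := IsIntegrallyClosed.isIntegral_iff.mp hint
  refine ⟨H, ?_⟩
  apply IsFractionRing.injective L[X] (RatFunc L)
  rw [hh]; simp

theorem aux_trace (F K : Type) [Field F] [Field K] [Algebra F K] [Fintype F] [Fintype K]
    (b : K) : Algebra.trace F K (b ^ Fintype.card F - b) = 0 := by
  rw [map_sub, sub_eq_zero]
  exact Algebra.trace_eq_of_algEquiv (FiniteField.frobeniusAlgEquivOfAlgebraic F K) b

theorem aux_h90 (F K : Type) [Field F] [Field K] [Algebra F K] [Fintype F] [Fintype K]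
    (c : K) (hc : Algebra.trace F K c = 0) : ∃ b : K, b ^ Fintype.card F - b = c := by
  let φ : K →ₗ[F] K := (FiniteField.frobeniusAlgEquivOfAlgebraic F K).toLinearMap - LinearMap.id
  have hφ : ∀ b, φ b = b ^ Fintype.card F - b := fun b => rfl
  have hle : LinearMap.range φ ≤ LinearMap.ker (Algebra.trace F K) := by
    rintro _ ⟨b, rfl⟩
    rw [LinearMap.mem_ker, hφ]
    exact aux_trace F K b
  have hker : Module.finrank F (LinearMap.ker φ) ≤ 1 := by
    rw [finrank_le_one_iff]
    refine ⟨⟨1, by simp [hφ]⟩, ?_⟩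
    rintro ⟨w, hw⟩
    rw [LinearMap.mem_ker, hφ, sub_eq_zero] at hw
    have : w ∈ Set.range (algebraMap F K) := by
      have hfix := (IsGalois.mem_range_algebraMap_iff_fixed (F := F) (E := K) w).mpr
      apply hfix
      intro f
      obtain ⟨n, rfl⟩ := (FiniteField.bijective_frobeniusAlgEquivOfAlgebraic_pow F K).2 f
      have hone : FiniteField.frobeniusAlgEquivOfAlgebraic F K w = w := hw
      simp only [AlgEquiv.coe_pow]
      exact Function.iterate_fixed hone _
    obtain ⟨a, rfl⟩ := this
    exact ⟨a, by ext; simp [Algebra.smul_def]⟩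
  have h1 := LinearMap.finrank_range_add_finrank_ker φ
  have h2 := LinearMap.finrank_range_add_finrank_ker (Algebra.trace F K)
  rw [LinearMap.range_eq_top.mpr (Algebra.trace_surjective F K), finrank_top,
    Module.finrank_self] at h2
  have heq := Submodule.eq_of_le_of_finrank_le hle (by omega)
  have : c ∈ LinearMap.range φ := by rw [heq]; exact hc
  obtain ⟨b, hb⟩ := this
  exact ⟨b, by rw [← hφ, hb]⟩

/-- With `K = {f : deg f ≤ k, Tr(f(x)) = 0 ∀x ∈ 𝔽_{q^m}}` and
`E = {h^q − h : deg h ≤ ⌊k/q⌋}`, if `K ≠ E` then some `f ∈ K \ E` is not of the form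
`h^p − h` with `h ∈ 𝔽̄(z)`. -/
theorem stmt_8 (p r m : ℕ) (hp : p.Prime) (hr : 1 ≤ r) (hm : 2 ≤ m)
    (F K : Type) [Field F] [Field K] [Algebra F K] [Fintype F] [Fintype K]
    (hF : Fintype.card F = p ^ r) (hK : Fintype.card K = (p ^ r) ^ m)
    (k : ℕ)
    (Kset Eset : Set K[X])
    (hKset : Kset = {f : K[X] | f.natDegree ≤ k ∧
      ∀ x : K, Algebra.trace F K (f.eval x) = 0})
    (hEset : Eset = {f : K[X] | ∃ h : K[X], h.natDegree ≤ k / p ^ r ∧ f = h ^ p ^ r - h})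
    (hne : Kset ≠ Eset) :
    ∃ f ∈ Kset \ Eset,
      ¬ ∃ h : RatFunc (AlgebraicClosure K),
        ratFuncMap (algebraMap K (AlgebraicClosure K)) (f : RatFunc K) = h ^ p - h := by
  classical
  haveI : Fact p.Prime := ⟨hp⟩
  have hKc : Fintype.card K = p ^ (r * m) := by rw [hK, pow_mul]
  haveI : CharP K p := charP_of_card_eq_prime_pow hKc
  have hq : 1 < p ^ r := Nat.one_lt_pow (by omega) hp.one_lt
  set q := p ^ r with hqdef
  have hsub : ∀ u v : K[X], (u - v) ^ q = u ^ q - v ^ q := fun u v => sub_pow_char_pow ..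
  have hadd : ∀ u v : K[X], (u + v) ^ q = u ^ q + v ^ q := fun u v => add_pow_char_pow ..
  have hEK : Eset ⊆ Kset := by
    rw [hEset, hKset]
    rintro _ ⟨h, hd, rfl⟩
    have hm1 : q * (k / q) ≤ k := Nat.mul_div_le k q
    refine ⟨(natDegree_sub_le _ _).trans (max_le ?_ ?_), fun x => ?_⟩
    · rw [natDegree_pow]; exact (Nat.mul_le_mul_left q hd).trans hm1
    · exact hd.trans (Nat.div_le_self k q)
    · rw [eval_sub, eval_pow, ← hF]; exact aux_trace F K _
  by_contra hcon
  push Not at hcon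
  have hex : ∃ d, ∃ f ∈ Kset \ Eset, f.natDegree = d := by
    by_contra hno
    push Not at hno
    apply hne
    refine Set.Subset.antisymm (fun f hf => ?_) hEK
    by_contra hfE
    exact hno _ f ⟨hf, hfE⟩ rfl
  obtain ⟨f, ⟨hfK, hfE⟩, hfd⟩ := Nat.find_spec hex
  have hmin : ∀ g ∈ Kset \ Eset, f.natDegree ≤ g.natDegree := by
    intro g hg
    rw [hfd]
    exact Nat.find_min' hex ⟨g, hg, rfl⟩
  clear hfd
  have hfk : f.natDegree ≤ k := by rw [hKset] at hfK; exact hfK.1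
  have hftr : ∀ x : K, Algebra.trace F K (f.eval x) = 0 := by rw [hKset] at hfK; exact hfK.2
  have hd0 : f.natDegree ≠ 0 := by
    intro h0
    rw [eq_C_of_natDegree_eq_zero h0] at hftr hfE
    obtain ⟨b, hb⟩ := aux_h90 F K (f.coeff 0) (by simpa using hftr 0)
    apply hfE
    rw [hEset]
    refine ⟨C b, by simp, ?_⟩
    rw [← hb, hF]; simp
  have hf0 : f ≠ 0 := by rintro rfl; simp at hd0
  have hqd : ¬ q ∣ f.natDegree := by
    rintro ⟨e, he⟩
    have he0 : e ≠ 0 := by rintro rfl; simp at he; omega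
    have hek : e ≤ k / q := by
      rw [Nat.le_div_iff_mul_le (by omega)]; rw [mul_comm]; omega
    obtain ⟨b, hb⟩ : ∃ b : K, b ^ q = f.leadingCoeff :=
      (bijective_iterateFrobenius K p r).2 f.leadingCoeff
    set t : K[X] := C b * X ^ e with ht
    have htd : t.natDegree ≤ e := natDegree_C_mul_X_pow_le _ _
    have htE : t ^ q - t ∈ Eset := by
      rw [hEset]; exact ⟨t, htd.trans hek, rfl⟩
    have htq : t ^ q = C f.leadingCoeff * X ^ f.natDegree := by
      rw [ht, mul_pow, ← C_pow, hb, ← pow_mul, mul_comm e q, ← he]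
    have hlt : (f - (t ^ q - t)).natDegree < f.natDegree := by
      have h1 : f - (t ^ q - t) = f.eraseLead + t := by
        rw [htq, ← self_sub_C_mul_X_pow]; ring
      rw [h1]
      refine (natDegree_add_le _ _).trans_lt (max_lt ?_ ?_)
      · have := eraseLead_natDegree_le f; omega
      · rw [he] ; refine htd.trans_lt ?_
        nlinarith [Nat.pos_of_ne_zero he0]
    refine absurd (hmin (f - (t ^ q - t)) ⟨?_, ?_⟩) (by omega)
    · have h2 := hEK htE
      rw [hKset] at h2 ⊢
      refine ⟨by omega, fun x => ?_⟩
      rw [eval_sub, map_sub, hftr, h2.2, sub_zero]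
    · intro h3
      apply hfE
      rw [hEset] at h3 ⊢
      obtain ⟨h, hh, h4⟩ := h3
      refine ⟨h + t, (natDegree_add_le _ _).trans (max_le hh (htd.trans hek)), ?_⟩
      rw [hadd, eq_add_of_sub_eq h4]; ring
  obtain ⟨j, n, hpn, hjn⟩ := Nat.exists_eq_pow_mul_and_not_dvd hd0 p hp.ne_one
  have hjr : j < r := by
    by_contra hjr
    apply hqd
    rw [hjn]
    exact Dvd.dvd.mul_right (pow_dvd_pow p (by omega)) n
  rw [mul_comm] at hjn
  let P : K[X] := ∑ i ∈ Finset.range (j + 1), C (f.coeff (n * p ^ i) ^ p ^ (j - i)) * X ^ p ^ (j - i)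
  have hPd : P.natDegree < q := by
    refine lt_of_le_of_lt ?_ (Nat.pow_lt_pow_right hp.one_lt hjr)
    apply natDegree_sum_le_of_forall_le
    intro i _
    exact (natDegree_C_mul_X_pow_le _ _).trans (Nat.pow_le_pow_right hp.pos (by omega))
  have hP1 : P.coeff 1 = f.leadingCoeff := by
    simp only [P, finset_sum_coeff, coeff_C_mul_X_pow]
    rw [Finset.sum_eq_single j]
    · simp [leadingCoeff, hjn]
    · intro i hi hij
      rw [if_neg]
      have : i ≤ j := by simpa [Nat.lt_succ_iff] using hi
      have := Nat.one_lt_pow (n := j - i) (by omega) hp.one_lt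
      omega
    · simp
  have hProot : ∀ a : F, P.eval (algebraMap F K a) = 0 := by
    intro a
    have hev : P.eval (algebraMap F K a) = ∑ i ∈ Finset.range (j + 1),
        ((C (algebraMap F K a) * f).coeff (n * p ^ i)) ^ p ^ (j - i) := by
      simp only [P, eval_finset_sum, eval_mul, eval_C, eval_pow, eval_X, coeff_C_mul]
      refine Finset.sum_congr rfl fun i _ => ?_
      rw [mul_pow, mul_comm]
    rw [hev]
    by_cases ha : a = 0
    · subst ha
      refine Finset.sum_eq_zero fun i _ => ?_
      simp [hp.ne_zero]
    have hmem : C (algebraMap F K a) * f ∈ Kset \ Eset := by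
      constructor
      · rw [hKset]
        refine ⟨(natDegree_C_mul_le _ _).trans hfk, fun x => ?_⟩
        rw [eval_mul, eval_C, ← Algebra.smul_def, map_smul, hftr, smul_zero]
      · intro h3
        apply hfE
        rw [hEset] at h3 ⊢
        obtain ⟨h, hh, h4⟩ := h3
        refine ⟨C (algebraMap F K a⁻¹) * h, (natDegree_C_mul_le _ _).trans hh, ?_⟩
        have h5 : f = C (algebraMap F K a⁻¹) * (C (algebraMap F K a) * f) := by
          rw [← mul_assoc, ← C_mul, ← map_mul, inv_mul_cancel₀ ha]; simp
        have h6 : (a⁻¹) ^ q = a⁻¹ := by rw [← hF]; exact FiniteField.pow_card _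
        rw [mul_pow, ← C_pow, ← map_pow, h6, ← mul_sub, ← h4, ← h5]
    obtain ⟨h, hh⟩ := hcon _ hmem
    have hmap : ratFuncMap (algebraMap K (AlgebraicClosure K))
        ((C (algebraMap F K a) * f : K[X]) : RatFunc K)
        = algebraMap _ _ ((C (algebraMap F K a) * f).map (algebraMap K (AlgebraicClosure K))) := by
      rw [RatFunc.coePolynomial_eq_algebraMap, ratFuncMap, RatFunc.coe_mapRingHom_eq_coe_map]
      have := RatFunc.map_apply_div (mapRingHom (algebraMap K (AlgebraicClosure K))) (by
        intro q hq
        simp only [Submonoid.mem_comap, coe_mapRingHom]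
        rw [mem_nonZeroDivisors_iff_ne_zero] at hq ⊢
        exact (Polynomial.map_ne_zero_iff (RingHom.injective _)).mpr hq)
        (C (algebraMap F K a) * f) 1
      simpa using this
    rw [hmap] at hh
    obtain ⟨H, hH⟩ := aux_poly p hp _ h hh
    haveI : CharP (AlgebraicClosure K) p := charP_of_injective_algebraMap
      (algebraMap K (AlgebraicClosure K)).injective p
    have h7 := aux_coeff p H _ hH n hpn j (by
      rw [natDegree_map, ← hjn]; exact natDegree_C_mul_le _ _)
    apply (algebraMap K (AlgebraicClosure K)).injective
    rw [map_zero, ← h7, map_sum]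
    refine Finset.sum_congr rfl fun i _ => ?_
    rw [map_pow, coeff_map]
  have hP0 : P = 0 := eq_zero_of_natDegree_lt_card_of_eval_eq_zero P
    (algebraMap F K).injective hProot (by rw [hF]; exact hPd)
  rw [hP0, coeff_zero] at hP1
  exact hf0 (leadingCoeff_eq_zero.mp hP1.symm)
end

section
/- Let p be a prime, q = p^r with r ≥ 1, m ≥ 2, and let k be an integer with k ≥ 0 and (k−1)² < q^m. Then every polynomial f ∈ 𝔽_{q^m}[z] of degree at most k satisfying Tr(f(x)) = 0 for all x ∈ 𝔽_{q^m} is of the form f = h^q − h for some h ∈ 𝔽_{q^m}[z] with deg h ≤ ⌊k/q⌋; that is, K = E where K = { f ∈ 𝔽_{q^m}[z] : deg f ≤ k, Tr(f(x)) = 0 for all x ∈ 𝔽_{q^m} } and E = { h^q − h : h ∈ 𝔽_{q^m}[z], deg h ≤ ⌊k/q⌋ }. -/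
open Polynomial

/-- Arithmetic of `q`-cyclotomic cosets modulo `q^m - 1`. -/
theorem aux_arith (q m c d j i : ℕ) (hq : 2 ≤ q) (hm : 2 ≤ m) (hc1 : 2 * c ≤ m + 1)
    (hd : d < q ^ c) (hqd : ¬ q ∣ d) (hj : j ≤ d) (hi : i < m)
    (hdvd : q ^ m - 1 ∣ (q ^ m - 1 - d) + j * q ^ i) : j = d ∧ i = 0 := by
  have hd0 : 0 < d := Nat.pos_of_ne_zero (by rintro rfl; simp at hqd)
  have hcm : c + 1 ≤ m := by omega
  have hcQ : q ^ c * q ≤ q ^ m := by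
    rw [← pow_succ]; exact Nat.pow_le_pow_right (by omega) hcm
  have hdN : d < q ^ m - 1 := by nlinarith [Nat.sub_add_cancel (show 1 ≤ q ^ m by nlinarith)]
  have hQ1 : 1 ≤ q ^ m := by omega
  -- small multiples are determined by their residue
  have key : ∀ a e : ℕ, a < q ^ c → 1 ≤ e → e + c ≤ m → a * q ^ e < q ^ m - 1 := by
    intro a e ha he hec
    have h1 : q ^ c * q ^ e ≤ q ^ m := by
      rw [← pow_add]; exact Nat.pow_le_pow_right (by omega) (by omega)
    have h2 : 2 ≤ q ^ e := le_trans hq (Nat.le_self_pow (by omega) q)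
    have h3 : (a + 1) * q ^ e ≤ q ^ c * q ^ e := Nat.mul_le_mul_right _ ha
    have h4 : (a + 1) * q ^ e = a * q ^ e + q ^ e := by ring
    omega
  have hmod : j * q ^ i ≡ d [MOD q ^ m - 1] := by
    have h1 : (q ^ m - 1 - d) + j * q ^ i ≡ (q ^ m - 1 - d) + d [MOD q ^ m - 1] := by
      rw [Nat.sub_add_cancel hdN.le]
      exact ((Nat.modEq_zero_iff_dvd.2 hdvd).trans (Nat.modEq_zero_iff_dvd.2 dvd_rfl).symm)
    exact Nat.ModEq.add_left_cancel' _ h1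
  rcases Nat.eq_zero_or_pos i with rfl | hipos
  · refine ⟨?_, rfl⟩
    rw [pow_zero, mul_one] at hmod
    exact Nat.ModEq.eq_of_lt_of_lt hmod (by omega) hdN
  exfalso
  by_cases hic : i + c ≤ m
  · have h := Nat.ModEq.eq_of_lt_of_lt hmod (key j i (by omega) hipos hic) hdN
    apply hqd
    rw [← h]
    exact Dvd.dvd.mul_left (dvd_pow_self q (by omega)) j
  · have h1 : j * q ^ i * q ^ (m - i) ≡ d * q ^ (m - i) [MOD q ^ m - 1] := hmod.mul_right _
    have h2 : j * q ^ i * q ^ (m - i) = j * q ^ m := by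
      rw [mul_assoc, ← pow_add]; congr 2; omega
    have h3 : q ^ m ≡ 1 [MOD q ^ m - 1] := ((Nat.modEq_iff_dvd' hQ1).2 dvd_rfl).symm
    have h4 : j ≡ d * q ^ (m - i) [MOD q ^ m - 1] := by
      rw [h2] at h1
      have := (h3.mul_left j).symm.trans h1
      rwa [mul_one] at this
    have h5 := Nat.ModEq.eq_of_lt_of_lt h4 (by omega) (key d (m - i) hd (by omega) (by omega))
    have h6 : 2 ≤ q ^ (m - i) := le_trans hq (Nat.le_self_pow (by omega) q)
    nlinarith

/-- Additive Hilbert 90 for power maps. -/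
theorem aux_hilbert {K : Type} [Field K] (p r m : ℕ) (hp : p.Prime) [CharP K p]
    (a t : K) (ht : ∑ i ∈ Finset.range m, t ^ ((p ^ r) ^ i) = 1)
    (htm : t ^ ((p ^ r) ^ m) = t)
    (ha : ∑ i ∈ Finset.range m, a ^ ((p ^ r) ^ i) = 0) : ∃ b : K, a = b ^ p ^ r - b := by
  have := Fact.mk hp
  set S : ℕ → K := fun n => ∑ j ∈ Finset.range n, a ^ ((p ^ r) ^ j) with hS
  have hS1 : ∀ n, (S n) ^ p ^ r = S (n + 1) - a := by
    intro n
    simp only [hS]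
    rw [sum_pow_char_pow, Finset.sum_range_succ']
    simp [← pow_mul, pow_succ]
  set b : K := ∑ i ∈ Finset.range m, S i * t ^ ((p ^ r) ^ i) with hb
  have h1 : b ^ p ^ r = b - a := by
    have h2 : b ^ p ^ r = ∑ i ∈ Finset.range m,
        (S (i + 1) * t ^ ((p ^ r) ^ (i + 1)) - a * t ^ ((p ^ r) ^ (i + 1))) := by
      rw [hb, sum_pow_char_pow]
      refine Finset.sum_congr rfl fun i _ => ?_
      rw [mul_pow, hS1, ← pow_mul, ← pow_succ, sub_mul]
    have e1 := Finset.sum_range_succ' (fun i => S i * t ^ ((p ^ r) ^ i)) m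
    rw [Finset.sum_range_succ] at e1
    have e2 := Finset.sum_range_succ' (fun i => t ^ ((p ^ r) ^ i)) m
    rw [Finset.sum_range_succ, ht, htm] at e2
    have hSm : S m = 0 := ha
    have hS0 : S 0 = 0 := by simp [hS]
    have e3 : ∑ i ∈ Finset.range m, t ^ ((p ^ r) ^ (i + 1)) = 1 := by
      simp only [pow_zero, pow_one] at e2
      linear_combination -e2
    rw [h2, Finset.sum_sub_distrib, ← Finset.mul_sum, e3]
    rw [hSm, hS0] at e1
    simp only [zero_mul, add_zero] at e1
    rw [← e1, mul_one]
  exact ⟨-b, by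
    have : (-b) ^ p ^ r = -(b ^ p ^ r) := by
      have := sub_pow_char_pow (R := K) (p := p) (n := r) 0 b
      simpa [hp.ne_zero] using this
    rw [this, h1]; ring⟩

theorem aux_coeff_s9 {K : Type} [Field K] [Fintype K] (p r m c d : ℕ) (hp : p.Prime) [CharP K p]
    (hr : 1 ≤ r) (hm : 2 ≤ m) (hK : Fintype.card K = (p ^ r) ^ m) (hc1 : 2 * c ≤ m + 1)
    (hd : d < (p ^ r) ^ c) (hqd : ¬ p ^ r ∣ d) (f : K[X]) (hf : f.natDegree ≤ d)
    (htr : ∀ x : K, ∑ i ∈ Finset.range m, (f.eval x) ^ ((p ^ r) ^ i) = 0) : f.coeff d = 0 := by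
  classical
  have := Fact.mk hp
  have hq : 2 ≤ p ^ r := le_trans hp.two_le (Nat.le_self_pow (by omega) p)
  have hdN : d ≤ (p ^ r) ^ m - 1 := by
    have : (p ^ r) ^ c ≤ (p ^ r) ^ m := Nat.pow_le_pow_right (by omega) (by omega)
    omega
  have hev : ∀ (x : K) (i : ℕ), (f.eval x) ^ ((p ^ r) ^ i) =
      ∑ j ∈ Finset.range (d + 1), (f.coeff j) ^ ((p ^ r) ^ i) * x ^ (j * (p ^ r) ^ i) := by
    intro x i
    rw [eval_eq_sum_range' (Nat.lt_succ_of_le hf), ← pow_mul p r i, sum_pow_char_pow]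
    refine Finset.sum_congr rfl fun j _ => ?_
    rw [mul_pow, ← pow_mul x]
  have h0 : ∑ u : Kˣ, (u : K) ^ ((p ^ r) ^ m - 1 - d) *
      ∑ i ∈ Finset.range m, (f.eval (u : K)) ^ ((p ^ r) ^ i) = 0 := by
    simp [htr]
  have h1 : ∑ i ∈ Finset.range m, ∑ j ∈ Finset.range (d + 1), (f.coeff j) ^ ((p ^ r) ^ i) *
      (∑ u : Kˣ, (u : K) ^ ((p ^ r) ^ m - 1 - d + j * (p ^ r) ^ i)) = 0 := by
    rw [← h0]
    simp only [hev, Finset.mul_sum]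
    symm
    rw [Finset.sum_comm]
    refine Finset.sum_congr rfl fun i _ => ?_
    rw [Finset.sum_comm]
    refine Finset.sum_congr rfl fun j _ => ?_
    refine Finset.sum_congr rfl fun u _ => ?_
    rw [pow_add]; ring
  have hsum : ∀ e : ℕ, ∑ u : Kˣ, (u : K) ^ e = if (p ^ r) ^ m - 1 ∣ e then -1 else 0 := by
    intro e
    have := FiniteField.sum_pow_units K e
    rw [hK] at this
    simpa using this
  simp only [hsum] at h1
  rw [Finset.sum_eq_single 0, Finset.sum_eq_single d] at h1
  · simpa [Nat.sub_add_cancel hdN] using h1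
  · intro j hj hjd
    rw [if_neg, mul_zero]
    intro hdv
    exact hjd (aux_arith (p ^ r) m c d j 0 hq hm hc1 hd hqd
      (by simp at hj; omega) (by omega) hdv).1
  · intro h; simp at h
  · intro i hi hi0
    refine Finset.sum_eq_zero fun j hj => ?_
    rw [if_neg, mul_zero]
    intro hdv
    exact hi0 (aux_arith (p ^ r) m c d j i hq hm hc1 hd hqd
      (by simp at hj; omega) (by simpa using hi) hdv).2
  · intro h; simp at h; omega

/-- For `q = p^r`, `m ≥ 2` and `0 ≤ k` with `(k−1)² < q^m`, every
`f ∈ 𝔽_{q^m}[z]` of degree at most `k` with `Tr(f(x)) = 0` for all `x ∈ 𝔽_{q^m}` is of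
the form `h^q − h` with `h ∈ 𝔽_{q^m}[z]`, `deg h ≤ ⌊k/q⌋` (i.e. `K = E`). -/
theorem stmt_9 (p r m : ℕ) (hp : p.Prime) (hr : 1 ≤ r) (hm : 2 ≤ m)
    (F K : Type) [Field F] [Field K] [Algebra F K] [Fintype F] [Fintype K]
    (hF : Fintype.card F = p ^ r) (hK : Fintype.card K = (p ^ r) ^ m)
    (k : ℕ) (hk : ((k : ℤ) - 1) ^ 2 < ((p : ℤ) ^ r) ^ m) :
    ∀ f : K[X], f.natDegree ≤ k → (∀ x : K, Algebra.trace F K (f.eval x) = 0) →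
      ∃ h : K[X], h.natDegree ≤ k / p ^ r ∧ f = h ^ p ^ r - h := by
  have := Fact.mk hp
  have : CharP K p := charP_of_card_eq_prime_pow (f := r * m) (by rw [hK, pow_mul])
  have hq : 2 ≤ p ^ r := le_trans hp.two_le (Nat.le_self_pow (by omega) p)
  have hfr : Module.finrank F K = m := by
    have h1 : Fintype.card K = Fintype.card F ^ Module.finrank F K := Module.card_eq_pow_finrank
    rw [hK, hF] at h1
    exact (Nat.pow_right_injective hq h1).symm
  have htrace : ∀ y : K, algebraMap F K (Algebra.trace F K y) =
      ∑ i ∈ Finset.range m, y ^ ((p ^ r) ^ i) := by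
    intro y
    rw [FiniteField.algebraMap_trace_eq_sum_pow, hfr, Nat.card_eq_fintype_card, hF]
  have hfrob : ∀ y : K, y ^ ((p ^ r) ^ m) = y := by
    intro y; rw [← hK]; exact FiniteField.pow_card y
  obtain ⟨t, ht⟩ := Algebra.trace_surjective F K 1
  have ht1 : ∑ i ∈ Finset.range m, t ^ ((p ^ r) ^ i) = 1 := by
    rw [← htrace, ht, map_one]
  set c := (m + 1) / 2 with hc
  have hkc : k ≤ (p ^ r) ^ c := by
    by_contra hlt
    push Not at hlt
    have h1 : (((p : ℤ) ^ r) ^ c) ≤ (k : ℤ) - 1 := by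
      have : (((p ^ r) ^ c : ℕ) : ℤ) + 1 ≤ (k : ℤ) := by exact_mod_cast hlt
      push_cast at this
      linarith
    have h2 : ((p : ℤ) ^ r) ^ m ≤ (((p : ℤ) ^ r) ^ c) ^ 2 := by
      rw [← pow_mul ((p : ℤ) ^ r)]
      exact pow_le_pow_right₀ (by exact_mod_cast (by omega : 1 ≤ p ^ r)) (by omega)
    have h3 : (0 : ℤ) ≤ ((p : ℤ) ^ r) ^ c := by positivity
    nlinarith
  -- induction on the degree
  have main : ∀ n : ℕ, n ≤ k → ∀ f : K[X], f.natDegree ≤ n →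
      (∀ x : K, ∑ i ∈ Finset.range m, (f.eval x) ^ ((p ^ r) ^ i) = 0) →
      ∃ h : K[X], h.natDegree ≤ k / p ^ r ∧ f = h ^ p ^ r - h := by
    intro n
    induction n with
    | zero =>
      intro _ f hf htr
      rw [eq_C_of_natDegree_le_zero hf] at htr ⊢
      obtain ⟨b, hb⟩ := aux_hilbert p r m hp (f.coeff 0) t ht1 (hfrob t) (by simpa using htr 0)
      exact ⟨C b, by simp, by rw [hb]; simp⟩
    | succ n ih =>
      intro hn f hf htr
      have lower : ∀ g : K[X], g.natDegree ≤ n + 1 → g.coeff (n + 1) = 0 → g.natDegree ≤ n := by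
        intro g hg hg0
        rw [natDegree_le_iff_coeff_eq_zero] at hg ⊢
        intro N hN
        rcases Nat.lt_or_ge (n + 1) N with h | h
        · exact hg N h
        · rw [show N = n + 1 by omega]; exact hg0
      by_cases hdv : p ^ r ∣ n + 1
      · obtain ⟨e, he⟩ := hdv
        -- a `q`-th root of the leading coefficient
        set b : K := (f.coeff (n + 1)) ^ ((p ^ r) ^ (m - 1)) with hb
        have hbq : b ^ p ^ r = f.coeff (n + 1) := by
          rw [hb, ← pow_mul, ← pow_succ, Nat.sub_add_cancel (by omega), hfrob]
        set M : K[X] := C b * X ^ e with hM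
        have hMq : M ^ p ^ r = C (f.coeff (n + 1)) * X ^ (n + 1) := by
          rw [hM, mul_pow, ← C_pow, hbq, ← pow_mul, mul_comm e, ← he]
        have hen : e ≤ n := by
          have : 2 * e ≤ p ^ r * e := Nat.mul_le_mul_right _ hq
          omega
        have hMd : M.natDegree ≤ e := natDegree_C_mul_X_pow_le b e
        have hgd : (f - (M ^ p ^ r - M)).natDegree ≤ n := by
          apply lower
          · have hMqd : (M ^ p ^ r).natDegree ≤ n + 1 := by
              rw [hMq]; exact natDegree_C_mul_X_pow_le _ _
            exact (natDegree_sub_le _ _).trans (max_le hf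
              ((natDegree_sub_le _ _).trans (max_le hMqd (by omega))))
          · rw [coeff_sub, coeff_sub, hMq, coeff_C_mul, coeff_X_pow, if_pos rfl,
              coeff_eq_zero_of_natDegree_lt (show M.natDegree < n + 1 by omega)]
            ring
        obtain ⟨h, hh, hfh⟩ := ih (by omega) _ hgd (by
          intro x
          have h1 := htr x
          have h2 : Algebra.trace F K ((M.eval x) ^ p ^ r) = Algebra.trace F K (M.eval x) := by
            apply (algebraMap F K).injective
            rw [htrace, htrace]
            have e2 := Finset.sum_range_succ' (fun i => (M.eval x) ^ ((p ^ r) ^ i)) m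
            rw [Finset.sum_range_succ, hfrob, pow_zero, pow_one] at e2
            rw [add_right_cancel e2]
            refine Finset.sum_congr rfl fun i _ => ?_
            rw [← pow_mul, ← pow_succ']
          rw [← htrace] at h1 ⊢
          rw [eval_sub, eval_sub, eval_pow, LinearMap.map_sub, LinearMap.map_sub, h2, sub_self,
            sub_zero, h1])
        refine ⟨h + M, (natDegree_add_le_of_degree_le hh ?_), ?_⟩
        · refine hMd.trans ?_
          rw [Nat.le_div_iff_mul_le (by omega), mul_comm, ← he]
          exact hn
        · rw [add_pow_char_pow]
          linear_combination hfh
      · have hlt : n + 1 < (p ^ r) ^ c := by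
          refine lt_of_le_of_ne (hn.trans hkc) fun h => hdv ?_
          rw [h]; exact dvd_pow_self _ (by omega)
        exact ih (by omega) f (lower f hf
          (aux_coeff_s9 p r m c (n + 1) hp hr hm hK (by omega) hlt hdv f hf htr)) htr
  intro f hf htr
  exact main k le_rfl f hf fun x => by rw [← htrace, htr, map_zero]
end

section
/- Let p be a prime, q = p^r with r ≥ 1, m ≥ 2. Let g ∈ 𝔽_{q^m}[z] be a nonconstant polynomial and write g = g₁^q · g₂ with g₁, g₂ ∈ 𝔽_{q^m}[z] and g₂ q-th power free. Suppose u ∈ 𝔽_{q^m}[z] with deg u < deg g and there exists h ∈ 𝔽_{q^m}(z) with u/g = h^q − h. Then there exists v ∈ 𝔽_{q^m}[z] with deg v < deg g₁ such that u/g = (v/g₁)^q − (v/g₁); moreover v/g₁ = h − b for some b ∈ 𝔽_q. -/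
open Polynomial

lemma aux_prod (F L : Type) [Field F] [Fintype F] [Field L] (f : F →+* L) (x : L) :
    x ^ Fintype.card F - x = ∏ b : F, (x - f b) := by
  have hdeg := FiniteField.X_pow_card_sub_X_natDegree_eq F (p := Fintype.card F) Fintype.one_lt_card
  have hmon : (X ^ Fintype.card F - X : F[X]).Monic := by
    apply monic_X_pow_sub
    rw [degree_X]
    exact_mod_cast Fintype.one_lt_card
  have hx : (X ^ Fintype.card F - X : F[X]) = ∏ b : F, (X - C b) := by
    have := prod_multiset_X_sub_C_of_monic_of_roots_card_eq hmon (by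
      rw [FiniteField.roots_X_pow_card_sub_X, hdeg]; rfl)
    rw [FiniteField.roots_X_pow_card_sub_X] at this
    exact this.symm
  have h := congrArg (eval₂ f x) hx
  simpa [eval₂_finsetProd] using h

lemma aux_dvd (K : Type) [Field K] (q : ℕ) (hq : 1 ≤ q) (b g₁ g₂ : K[X]) (hb : b ≠ 0)
    (hqfree : ¬ ∃ w : K[X], 0 < w.natDegree ∧ w ^ q ∣ g₂)
    (hd : b ^ q ∣ g₁ ^ q * g₂) : b ∣ g₁ := by
  classical
  have hd0 : gcd b g₁ ≠ 0 := fun h0 => hb ((gcd_eq_zero_iff _ _).1 h0).1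
  obtain ⟨b1, hb1⟩ := gcd_dvd_left b g₁
  obtain ⟨g1, hg1⟩ := gcd_dvd_right b g₁
  generalize hdd : gcd b g₁ = d at *
  have hcop : IsCoprime b1 g1 := by
    have hx := EuclideanDomain.gcd_isUnit_iff (x := b1) (y := g1)
    rw [← gcd_isUnit_iff]
    have := gcd_mul_left d b1 g1
    rw [← hb1, ← hg1, hdd] at this
    have h3 : Associated (d * gcd b1 g1) (d * 1) := by
      rw [mul_one]; nth_rw 2 [this]; exact (normalize_associated d).symm.mul_right _
    exact associated_one_iff_isUnit.1 (h3.of_mul_left (Associated.refl d) hd0)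
  rw [hb1, hg1, mul_pow, mul_pow, mul_assoc] at hd
  have h4 := (hcop.pow (m := q) (n := q)).dvd_of_dvd_mul_left ((mul_dvd_mul_iff_left (pow_ne_zero q hd0)).1 hd)
  have h5 : b1.natDegree = 0 := by
    by_contra h6
    exact hqfree ⟨b1, Nat.pos_of_ne_zero h6, h4⟩
  have h7 : b1 ≠ 0 := by rintro rfl; simp at hb1; exact hb hb1
  have h8 : IsUnit b1 := isUnit_iff_degree_eq_zero.2 (by rw [degree_eq_natDegree h7, h5]; rfl)
  rw [hb1, hg1]
  exact mul_dvd_mul_left d h8.dvd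

/-- If `g = g₁^q g₂` with `g₂` `q`-th power free and `u/g = h^q − h`
with `deg u < deg g`, `h ∈ 𝔽_{q^m}(z)`, then `u/g = (v/g₁)^q − v/g₁` for some polynomial
`v` with `deg v < deg g₁`; moreover `v/g₁ = h − b` for some `b ∈ 𝔽_q`. -/
theorem stmt_10 (p r m : ℕ) (hp : p.Prime) (hr : 1 ≤ r) (hm : 2 ≤ m)
    (F K : Type) [Field F] [Field K] [Algebra F K] [Fintype F] [Fintype K]
    (hF : Fintype.card F = p ^ r) (hK : Fintype.card K = (p ^ r) ^ m)
    (g g₁ g₂ : K[X]) (hg : 0 < g.natDegree)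
    (hfact : g = g₁ ^ p ^ r * g₂)
    (hqfree : ¬ ∃ w : K[X], 0 < w.natDegree ∧ w ^ p ^ r ∣ g₂)
    (u : K[X]) (hu : u.degree < g.degree)
    (h : RatFunc K)
    (heq : (u : RatFunc K) / (g : RatFunc K) = h ^ p ^ r - h) :
    ∃ (v : K[X]) (b : F), v.degree < g₁.degree ∧
      (u : RatFunc K) / (g : RatFunc K) =
        ((v : RatFunc K) / (g₁ : RatFunc K)) ^ p ^ r -
          (v : RatFunc K) / (g₁ : RatFunc K) ∧
      (v : RatFunc K) / (g₁ : RatFunc K) = h - RatFunc.C (algebraMap F K b) := by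
  have hq : 1 ≤ p ^ r := Nat.one_le_pow _ _ hp.pos
  obtain ⟨n, hn⟩ : ∃ n, p ^ r = n + 1 := ⟨p ^ r - 1, by omega⟩
  have hg0 : g ≠ 0 := by rintro rfl; simp at hg
  have hg1 : g₁ ≠ 0 := by
    rintro rfl; apply hg0; rw [hfact, hn]; simp
  have inj := RatFunc.algebraMap_injective K
  have hne : ∀ x : K[X], x ≠ 0 → algebraMap K[X] (RatFunc K) x ≠ 0 := fun x hx => by
    simpa using hx
  change algebraMap K[X] (RatFunc K) u / algebraMap K[X] (RatFunc K) g = _ at heq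
  change ∃ (v : K[X]) (b : F), v.degree < g₁.degree ∧
      algebraMap K[X] (RatFunc K) u / algebraMap K[X] (RatFunc K) g =
        (algebraMap K[X] (RatFunc K) v / algebraMap K[X] (RatFunc K) g₁) ^ p ^ r -
          algebraMap K[X] (RatFunc K) v / algebraMap K[X] (RatFunc K) g₁ ∧
      algebraMap K[X] (RatFunc K) v / algebraMap K[X] (RatFunc K) g₁ =
        h - RatFunc.C (algebraMap F K b)
  have hdvd : h.denom ∣ g₁ := by
    apply aux_dvd K (p ^ r) hq h.denom g₁ g₂ h.denom_ne_zero hqfree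
    rw [← hfact]
    have h1 : u * h.denom ^ (n+1) = g * (h.num ^ (n+1) - h.num * h.denom ^ n) := by
      apply inj
      rw [hn] at heq
      have := hne _ h.denom_ne_zero
      have := hne _ hg0
      simp only [map_mul, map_sub, map_pow]
      have e := RatFunc.num_div_denom h
      generalize algebraMap K[X] (RatFunc K) h.num = A at *
      generalize algebraMap K[X] (RatFunc K) h.denom = B at *
      rw [div_eq_iff ‹_›, ← e, div_pow] at heq
      rw [heq]
      field_simp
      ring
    have hc := h.isCoprime_num_denom
    rcases Nat.eq_zero_or_pos n with hn0 | hn0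
    · exfalso
      have : 1 < p ^ r := Nat.one_lt_pow (by omega) hp.one_lt
      omega
    have h2 : IsCoprime (h.denom ^ (n+1)) (h.num ^ (n+1) - h.num * h.denom ^ n) := by
      apply IsCoprime.pow_left
      obtain ⟨k, rfl⟩ : ∃ k, n = k + 1 := ⟨n - 1, by omega⟩
      have := (hc.symm.pow_right (n := k+1+1)).add_mul_left_right (-(h.num * h.denom ^ k))
      have e : h.num ^ (k+1+1) - h.num * h.denom ^ (k+1) =
          h.num ^ (k+1+1) + h.denom * (-(h.num * h.denom ^ k)) := by ring
      rw [e]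
      exact this
    rw [hn]
    exact h2.dvd_of_dvd_mul_right (h1 ▸ Dvd.intro_left u rfl)
  obtain ⟨c, hc⟩ := hdvd
  obtain ⟨w, hw⟩ : ∃ w, w = h.num * c := ⟨_, rfl⟩
  have hc0 : c ≠ 0 := by rintro rfl; simp at hc; exact hg1 hc
  have hh : h = algebraMap K[X] (RatFunc K) w / algebraMap K[X] (RatFunc K) g₁ := by
    rw [hw, hc, map_mul, map_mul, mul_div_mul_right _ _ (hne _ hc0), RatFunc.num_div_denom]
  let f : F →+* RatFunc K := (RatFunc.C).comp (algebraMap F K)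
  have hv : ∀ b : F, algebraMap K[X] (RatFunc K) (w - C (algebraMap F K b) * g₁) /
      algebraMap K[X] (RatFunc K) g₁ = h - RatFunc.C (algebraMap F K b) := by
    intro b
    have := hne _ hg1
    rw [map_sub, map_mul, RatFunc.algebraMap_C, hh]
    field_simp
  have hprod := aux_prod F _ f h
  rw [hF] at hprod
  have hpoly : u * g₁ ^ p ^ r = g * ∏ b : F, (w - C (algebraMap F K b) * g₁) := by
    apply inj
    have e : ∏ b : F, (h - f b) = (∏ b : F, algebraMap K[X] (RatFunc K)
        (w - C (algebraMap F K b) * g₁)) / (algebraMap K[X] (RatFunc K) g₁) ^ p ^ r := by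
      rw [← hF, ← Finset.card_univ, ← Finset.prod_const, ← Finset.prod_div_distrib]
      exact Finset.prod_congr rfl fun b _ => (hv b).symm
    rw [hprod, e, div_eq_div_iff (hne _ hg0) (pow_ne_zero _ (hne _ hg1))] at heq
    rw [map_mul, map_mul, map_pow, map_prod, heq, mul_comm]
  obtain ⟨b, hb⟩ : ∃ b : F, (w - C (algebraMap F K b) * g₁).degree < g₁.degree := by
    by_contra hcon
    push Not at hcon
    have hd := congrArg degree hpoly
    rw [degree_mul, degree_mul, degree_pow, degree_prod] at hd
    have h1 : (p ^ r) • g₁.degree ≤ ∑ b : F, (w - C (algebraMap F K b) * g₁).degree := by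
      rw [← hF, ← Finset.card_univ, ← Finset.sum_const]
      exact Finset.sum_le_sum fun b _ => hcon b
    have h2 : u.degree + (p ^ r) • g₁.degree < g.degree + (p ^ r) • g₁.degree := by
      rw [← degree_pow]
      exact WithBot.add_lt_add_right (by rw [Ne, degree_eq_bot]; exact pow_ne_zero _ hg1) hu
    exact absurd hd (ne_of_lt (h2.trans_le (by gcongr)))
  refine ⟨w - C (algebraMap F K b) * g₁, b, hb, ?_, hv b⟩
  rw [hv b, heq, hprod]
  have := aux_prod F _ f (h - RatFunc.C (algebraMap F K b))
  rw [hF] at this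
  rw [this]
  refine (Fintype.prod_equiv (Equiv.addLeft b) _ _ fun x => ?_).symm
  simp [f, sub_sub]
end

section
/- Let p be a prime, q = p^r with r ≥ 1, m ≥ 2, and let k ≥ 0 be an integer. Then the set E = { f ∈ 𝔽_{q^m}[z] : deg f ≤ k and f = h^q − h for some h ∈ 𝔽_{q^m}(z) } equals { h^q − h : h ∈ 𝔽_{q^m}[z], deg h ≤ ⌊k/q⌋ }, and as an 𝔽_q-vector space it has dimension dim_{𝔽_q} E = m(⌊k/q⌋ + 1) − 1. -/
open Polynomial

lemma aux_root {F K : Type} [Field F] [Field K] [Algebra F K] [Fintype F] (h : K[X])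
    (hh : h ^ Fintype.card F = h) : ∃ a : F, h = C (algebraMap F K a) := by
  have h1 : 1 < Fintype.card F := Fintype.one_lt_card
  have key : ∏ a : F, (X - C a) = (X ^ Fintype.card F - X : F[X]) := by
    have := prod_multiset_X_sub_C_of_monic_of_roots_card_eq (p := (X ^ Fintype.card F - X : F[X]))
      (monic_X_pow_sub (by rw [degree_X]; exact_mod_cast h1))
      (by rw [FiniteField.roots_X_pow_card_sub_X, FiniteField.X_pow_card_sub_X_natDegree_eq F h1]
          rfl)
    rw [FiniteField.roots_X_pow_card_sub_X] at this
    exact this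
  have k2 := congrArg (Polynomial.aeval h) key
  simp only [map_prod, map_sub, map_pow, aeval_X, aeval_C, hh, sub_self] at k2
  obtain ⟨a, -, ha⟩ := Finset.prod_eq_zero_iff.1 k2
  exact ⟨a, sub_eq_zero.1 ha⟩

lemma aux_deg {K : Type} [Field K] (q k : ℕ) (hq : 1 < q) (h : K[X]) :
    (h ^ q - h).natDegree ≤ k ↔ h.natDegree ≤ k / q := by
  have hd : (h ^ q - h).natDegree = q * h.natDegree := by
    rcases Nat.eq_zero_or_pos h.natDegree with h0 | h0
    · obtain ⟨c, rfl⟩ := natDegree_eq_zero.1 h0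
      rw [← C_pow, ← C_sub]; simp
    · rw [natDegree_sub_eq_left_of_natDegree_lt, natDegree_pow]
      rw [natDegree_pow]; nlinarith
  rw [hd, Nat.le_div_iff_mul_le (by omega), mul_comm]

lemma aux_int {K : Type} [Field K] (q : ℕ) (hq : 1 < q) (f : K[X]) (h : RatFunc K)
    (hf : (f : RatFunc K) = h ^ q - h) : ∃ g : K[X], (g : RatFunc K) = h ∧ f = g ^ q - g := by
  have hi : IsIntegral K[X] h := by
    refine ⟨X ^ q - (X + C f), monic_X_pow_sub ?_, ?_⟩
    · rw [degree_X_add_C]; exact_mod_cast hq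
    · simp only [eval₂_sub, eval₂_add, eval₂_pow, eval₂_X, eval₂_C]
      change h ^ q - (h + (f : RatFunc K)) = 0
      rw [hf]; ring
  obtain ⟨g, hg⟩ := IsIntegrallyClosed.isIntegral_iff.1 hi
  refine ⟨g, hg, ?_⟩
  apply IsFractionRing.injective K[X] (RatFunc K)
  rw [map_sub, map_pow, hg]
  exact hf

lemma aux_finrank {F K : Type} [Field F] [Field K] [Algebra F K] [Fintype F] [Fintype K]
    (n : ℕ) : Module.finrank F ((degreeLT K n).restrictScalars F) = Module.finrank F K * n := by
  have e : (degreeLT K n) ≃ₗ[F] (Fin n → K) := (degreeLTEquiv K n).restrictScalars F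
  have := e.finrank_eq
  rw [Module.finrank_pi_fintype] at this
  simp at this
  rw [mul_comm]
  exact this

/-- For `q = p^r`, the set
`E = {f ∈ 𝔽_{q^m}[z] : deg f ≤ k, f = h^q − h for some h ∈ 𝔽_{q^m}(z)}` equals
`{h^q − h : h ∈ 𝔽_{q^m}[z], deg h ≤ ⌊k/q⌋}` and is an `𝔽_q`-vector space of dimension
`m(⌊k/q⌋ + 1) − 1`. -/
theorem stmt_11 (p r m : ℕ) (hp : p.Prime) (hr : 1 ≤ r) (hm : 2 ≤ m)
    (F K : Type) [Field F] [Field K] [Algebra F K] [Fintype F] [Fintype K]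
    (hF : Fintype.card F = p ^ r) (hK : Fintype.card K = (p ^ r) ^ m)
    (k : ℕ)
    (E : Set K[X])
    (hE : E = {f : K[X] | f.natDegree ≤ k ∧ ∃ h : RatFunc K,
      (f : RatFunc K) = h ^ p ^ r - h}) :
    E = {f : K[X] | ∃ h : K[X], h.natDegree ≤ k / p ^ r ∧ f = h ^ p ^ r - h} ∧
      ∃ W : Submodule F K[X], (W : Set K[X]) = E ∧
        Module.finrank F W = m * (k / p ^ r + 1) - 1 := by
  have hq : 1 < p ^ r := Nat.one_lt_pow (by omega) hp.one_lt
  have hE2 : E = {f : K[X] | ∃ h : K[X], h.natDegree ≤ k / p ^ r ∧ f = h ^ p ^ r - h} := by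
    rw [hE]
    ext f
    constructor
    · rintro ⟨hk, h, hf⟩
      obtain ⟨g, -, rfl⟩ := aux_int _ hq f h hf
      exact ⟨g, (aux_deg _ _ hq g).1 hk, rfl⟩
    · rintro ⟨g, hg, rfl⟩
      refine ⟨(aux_deg _ _ hq g).2 hg, (g : RatFunc K), ?_⟩
      change algebraMap K[X] (RatFunc K) _ = (algebraMap K[X] (RatFunc K) _) ^ _ - algebraMap K[X] (RatFunc K) _
      rw [map_sub, map_pow]
  refine ⟨hE2, ?_⟩
  have hfr : Module.finrank F K = m := by
    have h1 := Module.card_eq_pow_finrank (K := F) (V := K)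
    rw [hK, hF] at h1
    exact (Nat.pow_right_injective hq h1).symm
  set n := k / p ^ r + 1 with hn
  let φ : K[X] →ₗ[F] K[X] := (FiniteField.frobeniusAlgHom F K[X]).toLinearMap - LinearMap.id
  have hφ : ∀ h, φ h = h ^ p ^ r - h := fun h => by simp [φ, hF]
  let D : Submodule F K[X] := (degreeLT K n).restrictScalars F
  have hD : ∀ h : K[X], h ∈ D ↔ h.natDegree ≤ k / p ^ r := fun h => by
    change h ∈ degreeLT K n ↔ _
    rw [mem_degreeLT, hn, ← Nat.lt_succ_iff, Nat.succ_eq_add_one]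
    by_cases h0 : h = 0
    · subst h0; simp
    · exact (natDegree_lt_iff_degree_lt h0).symm
  have hDr : Module.finrank F D = m * n := by rw [← hfr]; exact aux_finrank n
  have : Module.Finite F D := Module.finite_of_finrank_pos (by rw [hDr]; positivity)
  refine ⟨LinearMap.range (φ.domRestrict D), ?_, ?_⟩
  · rw [hE2]
    ext f
    constructor
    · rintro ⟨⟨h, hh⟩, rfl⟩
      exact ⟨h, (hD h).1 hh, hφ h⟩
    · rintro ⟨h, hh, rfl⟩
      exact ⟨⟨h, (hD h).2 hh⟩, hφ h⟩
  · have h1 := LinearMap.finrank_range_add_finrank_ker (φ.domRestrict D)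
    have one_mem : (1 : K[X]) ∈ D := (hD 1).2 (by simp)
    have hker : LinearMap.ker (φ.domRestrict D) = Submodule.span F {(⟨1, one_mem⟩ : D)} := by
      ext ⟨h, hh⟩
      rw [LinearMap.mem_ker, Submodule.mem_span_singleton]
      change φ h = 0 ↔ _
      rw [hφ, sub_eq_zero]
      constructor
      · intro h2
        obtain ⟨a, rfl⟩ := aux_root (F := F) h (by rw [hF]; exact h2)
        refine ⟨a, Subtype.ext ?_⟩
        change a • (1 : K[X]) = _
        rw [Algebra.smul_def, mul_one]; rfl
      · rintro ⟨a, ha⟩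
        have ha' : a • (1 : K[X]) = h := congrArg Subtype.val ha
        rw [← ha', ← hF, _root_.smul_pow, one_pow, FiniteField.pow_card]
    rw [hker, finrank_span_singleton (by
      intro h0; exact one_ne_zero (congrArg Subtype.val h0)), hDr] at h1
    omega
end

section
/- Let p be a prime, q = p^r with r ≥ 1, m ≥ 2, let 𝔽̄ be an algebraic closure of 𝔽_{q^m}, and view 𝔽_{q^m}(z) ⊆ 𝔽̄(z). Suppose f ∈ 𝔽_{q^m}(z) satisfies f = h^p − h + a for some h ∈ 𝔽_{q^m}(z) and a ∈ 𝔽_{q^m}. Then for every y ∈ 𝔽_q: there exists w ∈ 𝔽̄(z) with y·f = w^p − w if and only if there exists w' ∈ 𝔽̄(z) with (y^{1/p} − y)·h = w'^p − w', where y^{1/p} denotes the unique p-th root of y in 𝔽_q. Equivalently, D(f) = { y ∈ 𝔽_q : y^{1/p} − y ∈ D(h) }. -/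
open Polynomial

/-- If `f = h^p − h + a` with `h ∈ 𝔽_{q^m}(z)`, `a ∈ 𝔽_{q^m}`, then for
every `y ∈ 𝔽_q` (with `p`-th root `y' = y^{1/p}` in `𝔽_q`): `y·f` is of the form `w^p − w`
over `𝔽̄(z)` iff `(y^{1/p} − y)·h` is; i.e. `D(f) = {y : y^{1/p} − y ∈ D(h)}`. -/
theorem stmt_13 (p r m : ℕ) (hp : p.Prime) (hr : 1 ≤ r) (hm : 2 ≤ m)
    (F K : Type) [Field F] [Field K] [Algebra F K] [Fintype F] [Fintype K]
    (hF : Fintype.card F = p ^ r) (hK : Fintype.card K = (p ^ r) ^ m)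
    (f h : RatFunc K) (a : K) (hf : f = h ^ p - h + RatFunc.C a) :
    ∀ y y' : F, y' ^ p = y →
      ((∃ w : RatFunc (AlgebraicClosure K),
          ratFuncMap (algebraMap K (AlgebraicClosure K))
            (RatFunc.C (algebraMap F K y) * f) = w ^ p - w) ↔
        (∃ w' : RatFunc (AlgebraicClosure K),
          ratFuncMap (algebraMap K (AlgebraicClosure K))
            (RatFunc.C (algebraMap F K (y' - y)) * h) = w' ^ p - w')) := by
  intro y y' hy
  have : Fact p.Prime := ⟨hp⟩
  have hcardK : Fintype.card K = p ^ (r * m) := by rw [hK, pow_mul]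
  have : CharP K p := by
    obtain ⟨c, hc⟩ := CharP.exists K
    obtain ⟨n, hcp, hn⟩ := FiniteField.card K c
    have h1 : p ∣ c ^ (n : ℕ) := by
      rw [← hn, hcardK]
      exact dvd_pow_self p (by positivity)
    have h2 : p = c := (Nat.prime_dvd_prime_iff_eq hp hcp).1 (hp.dvd_of_dvd_pow h1)
    rw [h2]; exact hc
  have : CharP (AlgebraicClosure K) p :=
    charP_of_injective_algebraMap (algebraMap K (AlgebraicClosure K)).injective p
  have : CharP (RatFunc (AlgebraicClosure K)) p :=
    charP_of_injective_ringHom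
      (RatFunc.C : AlgebraicClosure K →+* RatFunc (AlgebraicClosure K)).injective p
  set φ := ratFuncMap (algebraMap K (AlgebraicClosure K)) with hφ
  have hC : ∀ c : K, φ (RatFunc.C c) = RatFunc.C (algebraMap K (AlgebraicClosure K) c) := by
    intro c
    rw [hφ, ← RatFunc.algebraMap_C, ← RatFunc.algebraMap_C]
    rw [← div_one (algebraMap K[X] (RatFunc K) (C c)), ← map_one (algebraMap K[X] (RatFunc K))]
    unfold ratFuncMap
    rw [RatFunc.coe_mapRingHom_eq_coe_map, RatFunc.map_apply_div]
    simp
  obtain ⟨b, hb⟩ : ∃ b : AlgebraicClosure K,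
      b ^ p - b = algebraMap K (AlgebraicClosure K) (algebraMap F K y * a) := by
    have hdeg : (X ^ p - X - C (algebraMap K (AlgebraicClosure K) (algebraMap F K y * a)) :
        (AlgebraicClosure K)[X]).degree ≠ 0 := by
      have h2 := hp.two_le
      have : (X ^ p - X - C (algebraMap K (AlgebraicClosure K) (algebraMap F K y * a)) :
        (AlgebraicClosure K)[X]).natDegree = p := by
        rw [natDegree_sub_C, natDegree_sub_eq_left_of_natDegree_lt] <;> simp
        omega
      intro h0
      have := natDegree_eq_zero_iff_degree_le_zero.2 h0.le
      omega
    obtain ⟨b, hb⟩ := IsAlgClosed.exists_root _ hdeg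
    refine ⟨b, ?_⟩
    simp only [IsRoot, eval_sub, eval_pow, eval_X, eval_C] at hb
    exact sub_eq_zero.1 hb
  set B : RatFunc (AlgebraicClosure K) := φ (RatFunc.C (algebraMap F K y')) * φ h + RatFunc.C b
    with hB
  have key : φ (RatFunc.C (algebraMap F K y) * f) =
      (B ^ p - B) + φ (RatFunc.C (algebraMap F K (y' - y)) * h) := by
    have e1 : φ (RatFunc.C (algebraMap F K y)) * φ (RatFunc.C a) =
        (RatFunc.C b) ^ p - RatFunc.C b := by
      rw [← map_mul, ← map_mul, hC, ← hb, map_sub, map_pow]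
    have e2 : φ (RatFunc.C (algebraMap F K y)) = φ (RatFunc.C (algebraMap F K y')) ^ p := by
      rw [← hy]; simp only [map_pow]
    have e3 : B ^ p = φ (RatFunc.C (algebraMap F K y)) * φ h ^ p + RatFunc.C b ^ p := by
      rw [hB, add_pow_char, mul_pow, e2]
    rw [e3, hB, hf]
    simp only [map_mul, map_add, map_sub, map_pow]
    linear_combination e1
  clear_value B
  rw [key]
  constructor
  · rintro ⟨w, hw⟩
    refine ⟨w - B, ?_⟩
    rw [sub_pow_char]
    linear_combination hw
  · rintro ⟨w, hw⟩
    refine ⟨w + B, ?_⟩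
    rw [add_pow_char]
    linear_combination hw
end

section
/- Let p be a prime, q = p^r with r ≥ 1, m ≥ 2. Let g ∈ 𝔽_{q^m}[z] be a nonconstant polynomial with no zeros in 𝔽_{q^m}, let s be the number of distinct zeros of g in an algebraic closure, and write g = g₁^q · g₂ with g₁, g₂ ∈ 𝔽_{q^m}[z] and g₂ q-th power free. Assume (deg g + 2s − 2)·√(q^m) < q^m + 1. Then every u ∈ 𝔽_{q^m}[z] with deg u < deg g satisfying Tr(u(x)/g(x)) = 0 for all x ∈ 𝔽_{q^m} is of the form u/g = (v/g₁)^q − (v/g₁) for some v ∈ 𝔽_{q^m}[z] with deg v < deg g₁. -/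
open Polynomial
set_option linter.unusedSectionVars false

lemma distinct_mult_indep {k : Type*} [Field k] {ι : Type*} [Fintype ι] (α : k) (P : ι → k[X]) (e : ι → ℕ)
    (he : Function.Injective e) (hP : ∀ i, ∃ q : k[X], P i = (X - C α) ^ e i * q ∧ q.eval α ≠ 0)
    (l : ι → k) (hl : l ≠ 0) : ∑ i, C (l i) * P i ≠ 0 := by
  classical
  intro h0
  have hne : (Finset.univ.filter (fun i => l i ≠ 0)).Nonempty := by
    by_contra hcon
    apply hl
    funext i
    by_contra hi
    exact hcon ⟨i, by simpa using hi⟩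
  obtain ⟨i0, hi0, hmin⟩ := Finset.exists_min_image _ e hne
  simp only [Finset.mem_filter, Finset.mem_univ, true_and] at hi0 hmin
  obtain ⟨q, hq, hqe⟩ := hP i0
  have hd : (X - C α) ^ (e i0 + 1) ∣ C (l i0) * P i0 := by
    rw [← Finset.add_sum_erase _ _ (Finset.mem_univ i0)] at h0
    rw [eq_neg_of_add_eq_zero_left h0, dvd_neg]
    apply Finset.dvd_sum
    intro i hi
    by_cases hli : l i = 0
    · simp [hli]
    · obtain ⟨q', hq', -⟩ := hP i
      have h1 := hmin i hli
      have h2 : e i0 ≠ e i := fun h => (Finset.ne_of_mem_erase hi) (he h.symm)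
      rw [hq']
      apply Dvd.dvd.mul_left
      apply Dvd.dvd.mul_right
      exact pow_dvd_pow _ (by omega)
  rw [hq, pow_succ, mul_left_comm, mul_dvd_mul_iff_left (pow_ne_zero _ (X_sub_C_ne_zero α)), dvd_iff_isRoot] at hd
  simp [IsRoot] at hd
  exact hd.elim hi0 hqe


/-- Stepanov's method for Artin-Schreier equations. -/
theorem stepanov {k : Type*} [Field k] [IsAlgClosed k] (p : ℕ) [hp : Fact p.Prime] [CharP k p]
    (u g : k[X]) (α : k) (n : ℕ) (hn : ¬ p ∣ n) (g' : k[X]) (hg : g = (X - C α) ^ n * g')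
    (hg' : g'.eval α ≠ 0) (hu : u.eval α ≠ 0) (hd : u.natDegree ≤ g.natDegree)
    (a b : ℕ) (hab : a ≤ b) (c : k) (Z : Finset k)
    (hZ : ∀ x ∈ Z, x ^ p ^ (a + 1 + (b + 1)) = x ∧ g.eval x ≠ 0 ∧
      ∑ i ∈ Finset.range (a + 1 + (b + 1)), (u.eval x / g.eval x) ^ p ^ i = c) :
    Z.card ≤ p ^ (a + b + 1) + (3 * g.natDegree + 5) * p ^ (b + 1) := by
  classical
  have : ExpChar k p := ExpChar.prime Fact.out
  have hp2 : 2 ≤ p := hp.out.two_le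
  set d := g.natDegree with hd_def
  set A := p ^ b with hA
  set B := p ^ a + (2 * d + 4) with hB
  -- numerators
  let w : ℕ → k[X] := fun e => ∑ i ∈ Finset.range (e + 1), u ^ p ^ i * g ^ (p ^ e - p ^ i)
  have hwdeg : ∀ e, (w e).natDegree ≤ p ^ e * d := by
    intro e
    apply natDegree_sum_le_of_forall_le
    intro i hi
    have hi' : p ^ i ≤ p ^ e := Nat.pow_le_pow_right (by omega) (by simpa [Nat.lt_succ_iff] using hi)
    refine natDegree_mul_le.trans ?_
    have h1 := natDegree_pow_le (p := u) (n := p ^ i)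
    have h2 := natDegree_pow_le (p := g) (n := p ^ e - p ^ i)
    have h3 : p ^ i * u.natDegree ≤ p ^ i * d := Nat.mul_le_mul_left _ hd
    have h4 : p ^ i * d + (p ^ e - p ^ i) * d = p ^ e * d := by
      rw [← add_mul]; congr 1; omega
    rw [← hd_def] at h2
    omega
  have hweval : ∀ e x, g.eval x ≠ 0 → (w e).eval x = g.eval x ^ p ^ e *
      ∑ i ∈ Finset.range (e + 1), (u.eval x / g.eval x) ^ p ^ i := by
    intro e x hx
    simp only [w, eval_finsetSum, eval_mul, eval_pow, Finset.mul_sum]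
    apply Finset.sum_congr rfl
    intro i hi
    have hi' : p ^ i ≤ p ^ e := Nat.pow_le_pow_right (by omega) (by simpa [Nat.lt_succ_iff] using hi)
    obtain ⟨t, ht⟩ := Nat.exists_eq_add_of_le hi'
    rw [ht, Nat.add_sub_cancel_left, pow_add, div_pow]
    field_simp
  have hn0 : n ≠ 0 := by rintro rfl; simp at hn
  have hgα : g.eval α = 0 := by simp [hg, hn0]
  have hwα : ∀ e, (w e).eval α ≠ 0 := by
    intro e
    have : (w e).eval α = u.eval α ^ p ^ e := by
      simp only [w, eval_finsetSum, eval_mul, eval_pow, hgα]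
      rw [Finset.sum_range_succ, Finset.sum_eq_zero]
      · simp
      · intro i hi
        have : p ^ i < p ^ e := Nat.pow_lt_pow_right (by omega) (by simpa using hi)
        rw [zero_pow (by omega), mul_zero]
    rw [this]
    exact pow_ne_zero _ hu
  let ι := Fin A × Fin p × Fin B
  let R := p ^ (a + 1)
  let R' := p ^ (b + 1)
  let cp : ι → k[X] := fun t => (X - C α) ^ (R * (A - t.1)) * (X - C (α ^ p ^ (a + 1 + (b + 1)))) ^ (B - t.2.2) *
    ((C c * g ^ p ^ a - w a) ^ (t.2.1 : ℕ) * g ^ (p ^ a * (p - 1 - t.2.1)))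
  let hpl : ι → k[X] := fun t => (X - C α) ^ ((A - t.1) + (B - t.2.2) * R') *
    (w b ^ (t.2.1 : ℕ) * g ^ (p ^ b * (p - 1 - t.2.1)))
  have hXdeg : ∀ (y : k) (N : ℕ), ((X - C y) ^ N).natDegree ≤ N := fun y N => by simp
  have hfac : ∀ (q : k[X]) (e j : ℕ), q.natDegree ≤ p ^ e * d → j < p →
      (q ^ j * g ^ (p ^ e * (p - 1 - j))).natDegree ≤ p ^ e * d * (p - 1) := by
    intro q e j hq hj
    refine natDegree_mul_le.trans ?_
    have h1 := natDegree_pow_le (p := q) (n := j)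
    have h2 := natDegree_pow_le (p := g) (n := p ^ e * (p - 1 - j))
    have h3 : j * q.natDegree ≤ j * (p ^ e * d) := Nat.mul_le_mul_left _ hq
    have h4 : j * (p ^ e * d) + (p ^ e * (p - 1 - j)) * d = p ^ e * d * (p - 1) := by
      obtain ⟨t, ht⟩ : ∃ t, p - 1 = j + t := ⟨p - 1 - j, by omega⟩
      rw [ht, Nat.add_sub_cancel_left]; ring
    rw [← hd_def] at h2
    omega
  have hpe : ∀ e : ℕ, p ^ e * d * (p - 1) ≤ p ^ (e + 1) * d := by
    intro e
    calc p ^ e * d * (p - 1) ≤ p ^ e * d * p := Nat.mul_le_mul_left _ (by omega)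
      _ = p ^ (e + 1) * d := by ring
  have hcpdeg : ∀ t, (cp t).natDegree ≤ A * R + B + d * R := by
    intro t
    refine natDegree_mul_le.trans ?_
    have h1 : (C c * g ^ p ^ a - w a).natDegree ≤ p ^ a * d := by
      refine (natDegree_sub_le _ _).trans (max_le ?_ (hwdeg a))
      exact (natDegree_C_mul_le _ _).trans natDegree_pow_le
    have h2 := (hfac _ a t.2.1 h1 t.2.1.2).trans (hpe a)
    have h3 := natDegree_mul_le.trans (add_le_add (hXdeg α (R * (A - t.1)))
      (hXdeg (α ^ p ^ (a + 1 + (b + 1))) (B - t.2.2)))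
    have h4 : R * (A - t.1) ≤ A * R := by rw [mul_comm]; exact Nat.mul_le_mul_right _ (by omega)
    have h5 : p ^ (a + 1) * d = d * R := mul_comm _ _
    have h6 : B - (t.2.2 : ℕ) ≤ B := by omega
    omega
  have hhdeg : ∀ t, (hpl t).natDegree ≤ A + B * R' + d * R' := by
    intro t
    refine natDegree_mul_le.trans ?_
    have h2 := (hfac _ b t.2.1 (hwdeg b) t.2.1.2).trans (hpe b)
    have h3 := hXdeg α ((A - t.1) + (B - t.2.2) * R')
    have h4 : (B - t.2.2) * R' ≤ B * R' := Nat.mul_le_mul_right _ (by omega)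
    have h5 : p ^ (b + 1) * d = d * R' := mul_comm _ _
    omega
  -- linear algebra
  let Φ : (ι → k) →ₗ[k] degreeLT k (A * R + B + d * R + 1) :=
    { toFun := fun ν => ⟨∑ t, C (ν t) * cp t, by
        rw [mem_degreeLT]
        refine lt_of_le_of_lt degree_le_natDegree ?_
        rw [Nat.cast_lt, Nat.lt_succ_iff]
        exact natDegree_sum_le_of_forall_le _ _ fun t _ => (natDegree_C_mul_le _ _).trans (hcpdeg t)⟩
      map_add' := by
        intro x y
        ext1
        simp [add_mul, Finset.sum_add_distrib]
      map_smul' := by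
        intro x y
        ext1
        simp [mul_assoc, Finset.mul_sum, smul_eq_C_mul] }
  have hR2 : R ≤ R' := Nat.pow_le_pow_right (by omega) (by omega)
  have hker : LinearMap.ker Φ ≠ ⊥ := by
    apply LinearMap.ker_ne_bot_of_finrank_lt
    rw [(degreeLTEquiv k (A * R + B + d * R + 1)).finrank_eq]
    simp only [Module.finrank_fintype_fun_eq_card, Fintype.card_fin, Fintype.card_prod, ι]
    have e1 : R = p * p ^ a := by simp only [R]; ring
    have e2 : p ^ a ≤ A := Nat.pow_le_pow_right (by omega) hab
    have e3 : A * (p * B) = A * R + p * A * (2 * d + 4) := by rw [hB, e1]; ring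
    have hA0 : 1 ≤ A := Nat.one_le_pow _ _ (by omega)
    have e4 : 2 * A ≤ p * A := Nat.mul_le_mul_right _ hp2
    have e5 : R ≤ p * A := by rw [e1]; exact Nat.mul_le_mul_left _ e2
    have e6 : d * R ≤ d * (p * A) := Nat.mul_le_mul_left _ e5
    have e7 : d * 2 ≤ d * (p * A) := Nat.mul_le_mul_left _ (by omega)
    have e8 : p * A * (2 * d + 4) = 2 * (d * (p * A)) + 4 * (p * A) := by ring
    rw [e3, e8]
    omega
  obtain ⟨ν, hν, hν0⟩ := (Submodule.ne_bot_iff _).1 hker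
  have hν1 : ∑ t, C (ν t) * cp t = 0 := by
    have := congrArg Subtype.val (LinearMap.mem_ker.1 hν)
    simpa [Φ] using this
  have hroot : ∀ t, ∃ l : k, l ^ R = ν t := fun t => IsAlgClosed.exists_pow_nat_eq _ (by positivity)
  choose l hl using hroot
  have hl0 : l ≠ 0 := by
    rintro rfl
    apply hν0
    funext t
    rw [← hl t]
    exact zero_pow (by positivity)
  let H : k[X] := ∑ t, C (l t) * hpl t
  have hH0 : H ≠ 0 := by
    apply distinct_mult_indep α hpl (fun t => (A - t.1) + (B - t.2.2) * R' + n * (p ^ b * (p - 1 - t.2.1)))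
    · rintro ⟨i, j, e⟩ ⟨i', j', e'⟩ h
      simp only at h
      have hR'A : R' = A * p := by simp only [R', hA]; ring
      have hi := i.2
      have hi' := i'.2
      have hApos : 0 < A := by omega
      have key : ∀ (i : Fin A) (j : Fin p) (e : Fin B), (A - i) + (B - e) * R' + n * (p ^ b * (p - 1 - j))
          = (A - 1 - i) + A * ((B - e) * p + n * (p - 1 - j)) + 1 := by
        intro i j e
        have h1 : A - (i : ℕ) = (A - 1 - i) + 1 := by have := i.2; omega
        rw [h1, hR'A, ← hA]; ring
      rw [key, key] at h
      have h' := Nat.succ_injective h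
      have hmod := congrArg (· % A) h'
      have hdiv := congrArg (· / A) h'
      simp only [Nat.add_mul_mod_self_left, Nat.add_mul_div_left _ _ hApos] at hmod hdiv
      rw [Nat.mod_eq_of_lt (by omega), Nat.mod_eq_of_lt (by omega)] at hmod
      rw [Nat.div_eq_of_lt (by omega), Nat.div_eq_of_lt (by omega), zero_add, zero_add] at hdiv
      have hii : i = i' := Fin.ext (by omega)
      have hjm : n * (p - 1 - j) ≡ n * (p - 1 - j') [MOD p] := by
        have := congrArg (· % p) hdiv
        simpa [Nat.ModEq, Nat.mul_add_mod_self_right] using this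
      have hcop : Nat.gcd p n = 1 := (Nat.Prime.coprime_iff_not_dvd hp.out).2 hn
      have hjm2 := Nat.ModEq.cancel_left_of_coprime hcop hjm
      have hj := j.2
      have hj' := j'.2
      have hjj0 := Nat.ModEq.eq_of_lt_of_lt hjm2 (by omega) (by omega)
      have hjj : j = j' := Fin.ext (by omega)
      subst hjj
      have he2 := Nat.add_right_cancel hdiv
      have he3 := Nat.eq_of_mul_eq_mul_right (by omega) he2
      have he := e.2
      have he' := e'.2
      have hee : e = e' := Fin.ext (by omega)
      rw [hii, hee]
    · intro t
      refine ⟨w b ^ (t.2.1 : ℕ) * g' ^ (p ^ b * (p - 1 - t.2.1)), ?_, ?_⟩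
      · simp only [hpl]
        rw [hg, mul_pow, ← pow_mul, pow_add _ _ (n * _)]
        ring
      · simp [hwα, hg']
    · exact hl0
  have hHdeg : H.natDegree ≤ A + B * R' + d * R' := by
    apply natDegree_sum_le_of_forall_le
    intro t _
    exact (natDegree_C_mul_le _ _).trans (hhdeg t)
  have hHZ : Z ⊆ H.roots.toFinset := by
    intro x hx
    obtain ⟨h1, h2, h3⟩ := hZ x hx
    rw [Multiset.mem_toFinset, mem_roots hH0, IsRoot]
    apply pow_eq_zero_iff (n := R) (by positivity) |>.1
    set G := g.eval x with hG
    set v := c - ∑ i ∈ Finset.range (a + 1), (u.eval x / G) ^ p ^ i with hv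
    have hWR : (w b).eval x ^ R = G ^ (p ^ b * R) * v := by
      rw [hweval b x h2, mul_pow, ← pow_mul, ← hG]
      congr 1
      rw [hv, ← h3, Finset.sum_range_add _ (a + 1) (b + 1), add_sub_cancel_left]
      simp only [R]
      rw [sum_pow_char_pow]
      refine Finset.sum_congr rfl fun i _ => ?_
      rw [← pow_mul, ← pow_add, add_comm]
    have hcw : (C c * g ^ p ^ a - w a).eval x = G ^ p ^ a * v := by
      rw [eval_sub, hweval a x h2, eval_mul, eval_C, eval_pow, ← hG, hv]
      ring
    have hx𝒬 : (x - α) ^ (R' * R) = x - α ^ p ^ (a + 1 + (b + 1)) := by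
      have : R' * R = p ^ (a + 1 + (b + 1)) := by simp only [R, R']; rw [← pow_add, add_comm]
      rw [this, sub_pow_char_pow, h1]
    have hν2 := congrArg (eval x) hν1
    have hfin : (H.eval x) ^ R * G ^ (p ^ a * (p - 1)) = (∑ t, ν t * (cp t).eval x) * G ^ (p ^ b * R * (p - 1)) := by
      simp only [H, eval_finsetSum, eval_mul, eval_C]
      rw [show R = p ^ (a + 1) from rfl, sum_pow_char_pow, Finset.sum_mul, Finset.sum_mul]
      refine Finset.sum_congr rfl fun t _ => ?_
      rw [show p ^ (a + 1) = R from rfl, mul_pow, hl]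
      simp only [hpl, cp, eval_mul, eval_pow, hcw, eval_sub, eval_X, eval_C, ← hG]
      obtain ⟨s, hs⟩ : ∃ s, p - 1 = t.2.1 + s := ⟨p - 1 - t.2.1, by have := t.2.1.2; omega⟩
      rw [hs, Nat.add_sub_cancel_left, ← hx𝒬]
      have e1 : (eval x (w b) ^ (t.2.1 : ℕ)) ^ R = (G ^ (p ^ b * R) * v) ^ (t.2.1 : ℕ) := by
        rw [← pow_mul, mul_comm, pow_mul, hWR]
      rw [mul_pow, mul_pow, e1]
      generalize (A - (t.1 : ℕ)) = i1
      generalize (B - (t.2.2 : ℕ)) = i2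
      generalize x - α = y
      generalize (t.2.1 : ℕ) = j
      generalize R' = r'
      generalize R = r
      generalize p ^ b = pb
      generalize p ^ a = pa
      ring_nf
    have h0 : ∑ t, ν t * (cp t).eval x = 0 := by
      simpa [eval_finsetSum] using hν2
    rw [h0, zero_mul] at hfin
    exact (mul_eq_zero.1 hfin).resolve_right (pow_ne_zero _ h2)
  calc Z.card ≤ H.roots.toFinset.card := Finset.card_le_card hHZ
    _ ≤ Multiset.card H.roots := Multiset.toFinset_card_le _
    _ ≤ H.natDegree := card_roots' _
    _ ≤ A + B * R' + d * R' := hHdeg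
    _ ≤ _ := by
      have e1 : R' = p * A := by simp only [R', hA]; ring
      have e2 : A ≤ R' := by rw [e1]; nlinarith
      have e3 : p ^ a * R' = p ^ (a + b + 1) := by simp only [R']; ring
      rw [hB, add_mul, e3]
      show _ ≤ _ + (3 * d + 5) * R'
      nlinarith

section euler
variable {K k : Type} [Field K] [Fintype K] [Field k] [IsAlgClosed k] [Algebra K k] [Algebra.IsAlgebraic K k]

theorem frob_period (x : k) (j : ℕ) :
    x ^ (Fintype.card K) ^ j = x ↔ (minpoly K x).natDegree ∣ j := by
  have hi : IsIntegral K x := Algebra.IsIntegral.isIntegral x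
  rw [(minpoly.irreducible hi).natDegree_dvd_iff_dvd_X_pow_card_pow_sub_X, minpoly.dvd_iff]
  simp [sub_eq_zero]

theorem minpoly_roots (x : k) :
    ((minpoly K x).map (algebraMap K k)).roots =
      (Multiset.range (minpoly K x).natDegree).map (fun i => x ^ (Fintype.card K) ^ i) := by
  have hi : IsIntegral K x := Algebra.IsIntegral.isIntegral x
  have hne : (minpoly K x).map (algebraMap K k) ≠ 0 :=
    (Polynomial.map_ne_zero (minpoly.ne_zero hi))
  symm
  apply Multiset.eq_of_le_of_card_le
  · rw [Multiset.le_iff_subset]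
    · intro y hy
      rw [Multiset.mem_map] at hy
      obtain ⟨i, -, rfl⟩ := hy
      rw [mem_roots hne, IsRoot.def, eval_map_algebraMap]
      have h1 : ∀ i : ℕ, aeval (x ^ (Fintype.card K) ^ i) (minpoly K x) = 0 := by
        intro i
        induction i with
        | zero => simp
        | succ i ih =>
          rw [pow_succ, pow_mul]
          have := congrArg (FiniteField.frobeniusAlgHom K k) ih
          rw [← aeval_algHom_apply, map_zero, FiniteField.coe_frobeniusAlgHom] at this
          exact this
      exact h1 i
    · apply Multiset.Nodup.map_on _ (Multiset.nodup_range _)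
      have key : ∀ i j : ℕ, i < j → j < (minpoly K x).natDegree →
          x ^ (Fintype.card K) ^ i = x ^ (Fintype.card K) ^ j → False := by
        intro i j hij hj he
        obtain ⟨d, rfl⟩ := Nat.exists_eq_add_of_lt hij
        have hinj : ∀ (i : ℕ) (y z : k), y ^ (Fintype.card K) ^ i = z ^ (Fintype.card K) ^ i → y = z := by
          intro i
          induction i with
          | zero => intro y z h; simpa using h
          | succ i ih =>
            intro y z h
            apply ih
            rw [pow_succ, pow_mul, pow_mul] at h
            exact (FiniteField.frobeniusAlgHom K k).toRingHom.injective h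
        have h3 : x = x ^ (Fintype.card K) ^ (d + 1) := by
          apply hinj i
          rw [← pow_mul, ← pow_add, he]
          congr 2
          ring
        have h4 := (frob_period (K := K) x (d + 1)).1 h3.symm
        have := Nat.le_of_dvd (by omega) h4
        omega
      intro i hi j hj h
      rw [Multiset.mem_range] at hi hj
      rcases lt_trichotomy i j with h1 | h1 | h1
      · exact (key i j h1 hj h).elim
      · exact h1
      · exact (key j i h1 hi h.symm).elim
  · rw [Multiset.card_map, Multiset.card_range]
    calc _ ≤ ((minpoly K x).map (algebraMap K k)).natDegree := card_roots' _
      _ = _ := natDegree_map _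

theorem pow_minpoly_dvd (x : k) (h : K[X]) (hh : h ≠ 0) (j : ℕ) :
    minpoly K x ^ j ∣ h ↔ j ≤ (h.map (algebraMap K k)).rootMultiplicity x := by
  have hi : IsIntegral K x := Algebra.IsIntegral.isIntegral x
  have hirr := minpoly.irreducible hi
  have hfin : FiniteMultiplicity (minpoly K x) h :=
    FiniteMultiplicity.of_not_isUnit hirr.not_isUnit hh
  obtain ⟨h', h1, h2⟩ := hfin.exists_eq_pow_mul_and_not_dvd
  have hh' : h' ≠ 0 := by rintro rfl; simp at h2
  have hne : (minpoly K x).map (algebraMap K k) ≠ 0 :=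
    (Polynomial.map_ne_zero (minpoly.ne_zero hi))
  have hrm : (h.map (algebraMap K k)).rootMultiplicity x = multiplicity (minpoly K x) h := by
    conv_lhs => rw [h1]
    have e0 : rootMultiplicity x (h'.map (algebraMap K k)) = 0 := by
      apply rootMultiplicity_eq_zero
      rw [IsRoot.def, eval_map_algebraMap]
      intro h
      exact h2 (minpoly.dvd K x h)
    have e1 : rootMultiplicity x ((minpoly K x).map (algebraMap K k)) = 1 := by
      have hsep : ((minpoly K x).map (algebraMap K k)).Separable :=
        Polynomial.Separable.map (Algebra.IsSeparable.isSeparable K x)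
      apply le_antisymm (rootMultiplicity_le_one_of_separable hsep x)
      rw [Nat.one_le_iff_ne_zero, ← Nat.pos_iff_ne_zero, rootMultiplicity_pos hne, IsRoot.def, eval_map_algebraMap]
      exact minpoly.aeval K x
    classical
    rw [Polynomial.map_mul, Polynomial.map_pow, rootMultiplicity_mul, e0]
    · rw [← count_roots, roots_pow, Multiset.count_nsmul, count_roots, e1]; simp
    · exact mul_ne_zero (pow_ne_zero _ hne) (Polynomial.map_ne_zero hh')
  rw [hrm]
  exact hfin.pow_dvd_iff_le_multiplicity

variable (K k) in
/-- elements of `k` fixed by the `j`-th power of Frobenius (empty for `j = 0`) -/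
noncomputable def Xset (j : ℕ) : Finset k := by
  classical exact (X ^ (Fintype.card K) ^ j - X : k[X]).roots.toFinset

theorem Xset_zero : Xset K k 0 = ∅ := by
  simp [Xset]

theorem mem_Xset (j : ℕ) (x : k) : x ∈ Xset K k j ↔ j ≠ 0 ∧ x ^ (Fintype.card K) ^ j = x := by
  rcases eq_or_ne j 0 with rfl | hj
  · simp [Xset_zero]
  · have := FiniteField.X_pow_card_pow_sub_X_ne_zero k hj (Fintype.one_lt_card (α := K))
    simp [Xset, this, hj, sub_eq_zero]

theorem card_Xset (j : ℕ) (hj : j ≠ 0) : (Xset K k j).card = (Fintype.card K) ^ j := by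
  classical
  have h1 := FiniteField.X_pow_card_pow_sub_X_natDegree_eq k hj (Fintype.one_lt_card (α := K))
  obtain ⟨p, hc, n, hp, hn⟩ := FiniteField.card' K
  have : Fact p.Prime := ⟨hp⟩
  have : CharP k p := charP_of_injective_algebraMap (algebraMap K k).injective p
  have hs : (X ^ (Fintype.card K) ^ j - X : k[X]).Separable := by
    apply galois_poly_separable p
    rw [hn]
    exact dvd_pow (dvd_pow_self _ n.pos.ne') hj
  rw [Xset, Multiset.toFinset_card_of_nodup (nodup_roots hs)]
  exact (IsAlgClosed.splits (_ : k[X])).natDegree_eq_card_roots.symm.trans h1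

variable (K) in
/-- the monic polynomial of degree `j` attached to `x` -/
noncomputable def cK (j : ℕ) (x : k) : K[X] := minpoly K x ^ (j / (minpoly K x).natDegree)

theorem cK_monic (j : ℕ) (x : k) : (cK K j x).Monic :=
  (minpoly.monic (Algebra.IsIntegral.isIntegral x)).pow _

theorem cK_natDegree (j : ℕ) (x : k) (hx : x ∈ Xset K k j) : (cK K j x).natDegree = j := by
  rw [mem_Xset, frob_period] at hx
  rw [cK, natDegree_pow, Nat.div_mul_cancel hx.2]

open Classical in
theorem count_lemma (n : ℕ) (h : K[X]) (hm : h.Monic) (hn : h.natDegree = n) :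
    ∑ j ∈ Finset.range (n + 1), ((Xset K k j).filter (fun x => cK K j x ∣ h)).card = n := by
  classical
  have hne : h.map (algebraMap K k) ≠ 0 := Polynomial.map_ne_zero hm.ne_zero
  set R := (h.map (algebraMap K k)).roots with hR
  have hx : ∀ x : k, ((Finset.range (n + 1)).filter (fun j => x ∈ Xset K k j ∧ cK K j x ∣ h)).card =
      R.count x := by
    intro x
    have hi : IsIntegral K x := Algebra.IsIntegral.isIntegral x
    have hpos : 0 < (minpoly K x).natDegree := minpoly.natDegree_pos hi
    set e := (minpoly K x).natDegree with he
    have hv : e * R.count x ≤ n := by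
      have := (pow_minpoly_dvd x h hm.ne_zero _).2 le_rfl
      have h2 := natDegree_le_of_dvd this hm.ne_zero
      rw [natDegree_pow, hn] at h2
      rw [hR, count_roots, mul_comm]
      exact h2
    have : (Finset.range (n + 1)).filter (fun j => x ∈ Xset K k j ∧ cK K j x ∣ h) =
        (Finset.Icc 1 (R.count x)).image (e * ·) := by
      ext j
      simp only [Finset.mem_filter, Finset.mem_range, Finset.mem_image, Finset.mem_Icc, mem_Xset,
        frob_period, cK, ← he]
      constructor
      · rintro ⟨h1, ⟨h2, ⟨c, rfl⟩⟩, h3⟩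
        rw [Nat.mul_div_cancel_left _ hpos, pow_minpoly_dvd x h hm.ne_zero] at h3
        refine ⟨c, ⟨?_, ?_⟩, rfl⟩
        · by_contra hc
          have : c = 0 := by omega
          simp [this] at h2
        · rw [hR, count_roots]; exact h3
      · rintro ⟨c, ⟨h1, h2⟩, rfl⟩
        refine ⟨?_, ⟨?_, dvd_mul_right _ _⟩, ?_⟩
        · have := Nat.mul_le_mul_left e h2
          omega
        · have := Nat.mul_pos hpos h1
          omega
        · rw [Nat.mul_div_cancel_left _ hpos, pow_minpoly_dvd x h hm.ne_zero]
          rw [hR, count_roots] at h2; exact h2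
    rw [this, Finset.card_image_of_injective _ (fun a b h => Nat.eq_of_mul_eq_mul_left hpos h)]
    simp
  have h1 : ∀ j, ((Xset K k j).filter (fun x => cK K j x ∣ h)) =
      R.toFinset.filter (fun x => x ∈ Xset K k j ∧ cK K j x ∣ h) := by
    intro j
    ext x
    simp only [Finset.mem_filter, Multiset.mem_toFinset]
    constructor
    · rintro ⟨h1, h2⟩
      refine ⟨?_, h1, h2⟩
      rw [hR, mem_roots hne, IsRoot.def, eval_map_algebraMap]
      have h3 : aeval x (cK K j x) = 0 := by
        rw [cK, map_pow, minpoly.aeval, zero_pow]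
        have h4 := cK_natDegree j x h1
        rw [cK, natDegree_pow] at h4
        rw [mem_Xset] at h1
        intro h5
        rw [h5] at h4
        omega
      obtain ⟨w, rfl⟩ := h2
      simp [h3]
    · rintro ⟨-, h1, h2⟩
      exact ⟨h1, h2⟩
  simp_rw [h1, Finset.card_filter]
  rw [Finset.sum_comm]
  simp_rw [← Finset.card_filter, hx]
  rw [Multiset.toFinset_sum_count_eq, hR, ← hn, ← natDegree_map (algebraMap K k)]
  exact (IsAlgClosed.splits (_ : k[X])).natDegree_eq_card_roots.symm

theorem monic_finite (n : ℕ) : {h : K[X] | h.Monic ∧ h.natDegree = n}.Finite := by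
  have : Finite (degreeLT K n) := Module.finite_of_finite K
  have := (Polynomial.monicEquivDegreeLT (R := K) n).finite_iff.2 inferInstance
  exact this

variable (K) in
/-- monic polynomials of degree `n` -/
noncomputable def Mon (n : ℕ) : Finset K[X] := (monic_finite (K := K) n).toFinset

theorem mem_Mon (n : ℕ) (h : K[X]) : h ∈ Mon K n ↔ h.Monic ∧ h.natDegree = n := by
  simp [Mon]

variable (k) in
theorem euler_rec (χ : K[X] → ℂ) (hχ : ∀ a b : K[X], a.Monic → b.Monic → χ (a * b) = χ a * χ b) (n : ℕ) :
    (n : ℂ) * ∑ h ∈ Mon K n, χ h = ∑ x ∈ Finset.HasAntidiagonal.antidiagonal n,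
      (∑ y ∈ Xset K k x.1, χ (cK K x.1 y)) * ∑ h ∈ Mon K x.2, χ h := by
  classical
  rw [Finset.Nat.sum_antidiagonal_eq_sum_range_succ (fun i j => (∑ y ∈ Xset K k i, χ (cK K i y)) * ∑ h ∈ Mon K j, χ h)]
  have h1 : (n : ℂ) * ∑ h ∈ Mon K n, χ h = ∑ h ∈ Mon K n, ∑ j ∈ Finset.range (n + 1),
      ∑ x ∈ Xset K k j, if cK K j x ∣ h then χ h else 0 := by
    rw [Finset.mul_sum]
    apply Finset.sum_congr rfl
    intro h hh
    rw [mem_Mon] at hh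
    conv_lhs => rw [← count_lemma (k := k) n h hh.1 hh.2]
    rw [Nat.cast_sum, Finset.sum_mul]
    apply Finset.sum_congr rfl
    intro j _
    rw [← Finset.sum_filter, Finset.sum_const, nsmul_eq_mul]
  rw [h1, Finset.sum_comm]
  apply Finset.sum_congr rfl
  intro j hj
  rw [Finset.mem_range] at hj
  rw [Finset.sum_comm, Finset.sum_mul]
  apply Finset.sum_congr rfl
  intro x hx
  rw [← Finset.sum_filter, Finset.mul_sum]
  have hcm := cK_monic (K := K) j x
  have hcd := cK_natDegree j x hx
  symm
  apply Finset.sum_bij (fun h _ => cK K j x * h)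
  · intro h hh
    rw [mem_Mon] at hh
    rw [Finset.mem_filter, mem_Mon]
    refine ⟨⟨hcm.mul hh.1, ?_⟩, dvd_mul_right _ _⟩
    rw [hcm.natDegree_mul hh.1, hcd, hh.2]; omega
  · intro a _ b _ h
    exact mul_left_cancel₀ hcm.ne_zero h
  · intro b hb
    rw [Finset.mem_filter, mem_Mon] at hb
    obtain ⟨⟨h1, h2⟩, w, rfl⟩ := hb
    have hw : w.Monic := hcm.of_mul_monic_left h1
    refine ⟨w, ?_, rfl⟩
    rw [mem_Mon]
    refine ⟨hw, ?_⟩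
    rw [hcm.natDegree_mul hw, hcd] at h2; omega
  · intro h hh
    rw [mem_Mon] at hh
    exact (hχ _ _ hcm hh.1).symm
end euler

lemma ps_eval (S : ℕ → ℂ) (A P : ℂ[X]) (t : ℂ) (hS : Summable fun n => ‖S n * t ^ n‖)
    (h : PowerSeries.mk S * (A : PowerSeries ℂ) = (P : PowerSeries ℂ)) :
    (∑' n, S n * t ^ n) * A.eval t = P.eval t := by
  have hev : ∀ Q : ℂ[X], HasSum (fun n => Q.coeff n * t ^ n) (Q.eval t) := by
    intro Q
    rw [eval_eq_sum_range]
    apply hasSum_sum_of_ne_finset_zero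
    intro n hn
    rw [coeff_eq_zero_of_natDegree_lt (by simpa using hn), zero_mul]
  have hsn : ∀ Q : ℂ[X], Summable fun n => ‖Q.coeff n * t ^ n‖ := by
    intro Q
    apply summable_of_ne_finset_zero (s := Finset.range (Q.natDegree + 1))
    intro n hn
    rw [coeff_eq_zero_of_natDegree_lt (by simpa using hn), zero_mul, norm_zero]
  rw [← (hev A).tsum_eq, tsum_mul_tsum_eq_tsum_sum_antidiagonal_of_summable_norm hS (hsn A), ← (hev P).tsum_eq]
  congr 1
  funext n
  have := congrArg (PowerSeries.coeff n) h
  rw [PowerSeries.coeff_mul, coeff_coe] at this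
  rw [← this, Finset.sum_mul]
  refine Finset.sum_congr rfl fun x hx => ?_
  rw [← Finset.HasAntidiagonal.mem_antidiagonal.1 hx, PowerSeries.coeff_mk, coeff_coe]
  ring

theorem power_sum_bound (c S : ℕ → ℂ) (D : ℕ) (hc0 : c 0 = 1) (hcD : ∀ n, D + 1 ≤ n → c n = 0)
    (hrec : ∀ n : ℕ, (n : ℂ) * c n = ∑ x ∈ Finset.HasAntidiagonal.antidiagonal n, S x.1 * c x.2) (B ρ : ℝ) (hρ : 0 < ρ)
    (hS : ∀ n, ‖S n‖ ≤ B * ρ ^ n) : ‖c 1‖ ≤ D * ρ := by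
  classical
  let L : ℂ[X] := ∑ n ∈ Finset.range (D + 1), C (c n) * X ^ n
  have hLc : ∀ n, L.coeff n = c n := by
    intro n
    simp only [L, finsetSum_coeff, coeff_C_mul, coeff_X_pow]
    by_cases hn : n < D + 1
    · simp [hn]
    · rw [hcD n (by omega)]
      apply Finset.sum_eq_zero
      intro i hi
      simp only [Finset.mem_range] at hi
      rw [if_neg (by omega), mul_zero]
  have hL0 : L ≠ 0 := by
    intro h
    have := hLc 0
    rw [h, hc0] at this
    simp at this
  have hps : PowerSeries.mk S * (L : PowerSeries ℂ) = ((X * derivative L : ℂ[X]) : PowerSeries ℂ) := by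
    ext n
    rw [PowerSeries.coeff_mul, coeff_coe]
    simp only [PowerSeries.coeff_mk, coeff_coe, hLc]
    rw [← hrec]
    cases n with
    | zero => simp
    | succ n => rw [coeff_X_mul, coeff_derivative, hLc]; push_cast; ring
  have hroot : ∀ t : ℂ, ‖t‖ * ρ < 1 → L.eval t ≠ 0 := by
    intro t ht h0
    have hsum : Summable fun n => ‖S n * t ^ n‖ := by
      apply Summable.of_nonneg_of_le (fun _ => norm_nonneg _) (f := fun n => B * (‖t‖ * ρ) ^ n)
      · intro n
        rw [norm_mul, norm_pow, mul_pow]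
        have := mul_le_mul_of_nonneg_right (hS n) (pow_nonneg (norm_nonneg t) n)
        linarith
      · exact (summable_geometric_of_lt_one (by positivity) ht).mul_left B
    obtain ⟨L1, hL1, hL1d⟩ := exists_eq_pow_rootMultiplicity_mul_and_not_dvd L hL0 t
    have hk := (rootMultiplicity_pos hL0).2 h0
    obtain ⟨k, hk⟩ := Nat.exists_eq_succ_of_ne_zero hk.ne'
    rw [hk] at hL1
    have hder : X * derivative L = (X - C t) ^ k * (X * ((k + 1 : ℂ[X]) * L1 + (X - C t) * derivative L1)) := by
      conv_lhs => rw [hL1]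
      rw [derivative_mul, derivative_pow, derivative_sub, derivative_X, derivative_C]
      simp
      ring
    have hL2 : L = (X - C t) ^ k * ((X - C t) * L1) := by
      conv_lhs => rw [hL1]
      rw [Nat.succ_eq_add_one]; ring
    have hps2 : PowerSeries.mk S * (((X - C t) * L1 : ℂ[X]) : PowerSeries ℂ) =
        ((X * ((k + 1 : ℂ[X]) * L1 + (X - C t) * derivative L1) : ℂ[X]) : PowerSeries ℂ) := by
      rw [hder, hL2, Polynomial.coe_mul ((X - C t) ^ k), Polynomial.coe_mul ((X - C t) ^ k), mul_left_comm] at hps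
      refine mul_left_cancel₀ ?_ hps
      rw [Ne, Polynomial.coe_eq_zero_iff]
      exact pow_ne_zero _ (X_sub_C_ne_zero t)
    have := ps_eval S _ _ t hsum hps2
    simp only [eval_mul, eval_add, eval_sub, eval_X, eval_C, sub_self, zero_mul, mul_zero, add_zero] at this
    have hk1 : (eval t ((k : ℂ[X]) + 1)) ≠ 0 := by
      simp only [eval_add, eval_natCast, eval_one]
      exact Nat.cast_add_one_ne_zero k
    rcases mul_eq_zero.1 this.symm with h | h
    · subst h
      rw [← coeff_zero_eq_eval_zero, hLc, hc0] at h0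
      exact one_ne_zero h0
    · rcases mul_eq_zero.1 h with h | h
      · simp at h
        exact Nat.cast_add_one_ne_zero k h
      · exact hL1d (dvd_iff_isRoot.2 h)
  -- reverse polynomial
  rcases Nat.eq_zero_or_pos D with rfl | hDpos
  · rw [hcD 1 le_rfl]; simp
  let M : ℂ[X] := ∑ n ∈ Finset.range (D + 1), C (c n) * X ^ (D - n)
  have hMc : ∀ n ≤ D, M.coeff (D - n) = c n := by
    intro n hn
    simp only [M, finsetSum_coeff, coeff_C_mul, coeff_X_pow]
    rw [Finset.sum_eq_single n]
    · simp
    · intro i hi hin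
      simp only [Finset.mem_range] at hi
      rw [if_neg (by omega), mul_zero]
    · intro h; simp at h; omega
  have hMd : M.natDegree ≤ D := by
    apply natDegree_sum_le_of_forall_le
    intro i _
    exact (natDegree_C_mul_X_pow_le _ _).trans (by omega)
  have hMm : M.Monic := monic_of_natDegree_le_of_coeff_eq_one D hMd (by rw [← hc0, ← hMc 0 (by omega)]; simp)
  have hMD : M.natDegree = D := natDegree_eq_of_le_of_coeff_ne_zero hMd (by
    have := hMc 0 (by omega); rw [Nat.sub_zero, hc0] at this; rw [this]; exact one_ne_zero)
  have hMroot : ∀ z ∈ M.roots, ‖z‖ ≤ ρ := by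
    intro z hz
    by_contra hlt
    push Not at hlt
    have hz0 : z ≠ 0 := by rintro rfl; simp at hlt; linarith
    have hev := (mem_roots hMm.ne_zero).1 hz
    apply hroot z⁻¹
    · rw [norm_inv, inv_mul_lt_iff₀ (by linarith)]; linarith
    · have : M.eval z = z ^ D * L.eval z⁻¹ := by
        simp only [M, L, eval_finsetSum, eval_mul, eval_C, eval_pow, eval_X, Finset.mul_sum]
        refine Finset.sum_congr rfl fun n hn => ?_
        simp only [Finset.mem_range] at hn
        obtain ⟨e, he⟩ := Nat.exists_eq_add_of_le (Nat.lt_succ_iff.1 hn)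
        rw [he, Nat.add_sub_cancel_left, pow_add, inv_pow]
        field_simp
      rw [IsRoot, this] at hev
      exact (mul_eq_zero.1 hev).resolve_left (pow_ne_zero _ hz0)
  have hvieta : c 1 = - M.roots.sum := by
    rw [← hMc 1 (by omega), ← (IsAlgClosed.splits M).nextCoeff_eq_neg_sum_roots_of_monic hMm,
      nextCoeff_of_natDegree_pos (by omega), hMD]
  rw [hvieta, norm_neg]
  calc ‖M.roots.sum‖ ≤ (M.roots.map norm).sum := norm_multiset_sum_le _
    _ ≤ Multiset.card (M.roots.map norm) • ρ := by
      apply Multiset.sum_le_card_nsmul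
      intro x hx
      obtain ⟨z, hz, rfl⟩ := Multiset.mem_map.1 hx
      exact hMroot z hz
    _ ≤ D * ρ := by
      rw [Multiset.card_map, nsmul_eq_mul]
      gcongr
      exact (card_roots' M).trans hMd

section resid
variable {k : Type} [Field k]

theorem resid_one (u g : k[X]) (hg : g.Monic) (hu : u.degree < g.degree) (β : k) (hβ : g.eval β ≠ 0)
    (hd : 0 < g.natDegree) :
    ((u * (g /ₘ (X - C β))) %ₘ g).coeff (g.natDegree - 1) = u.eval β := by
  set G := g /ₘ (X - C β) with hG
  set U := u /ₘ (X - C β) with hU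
  have h1 : g = (X - C β) * G + C (g.eval β) := by
    have := modByMonic_add_div g (X - C β)
    rw [modByMonic_X_sub_C_eq_C_eval] at this
    rw [hG]; linear_combination -this
  have h2 : u = (X - C β) * U + C (u.eval β) := by
    have := modByMonic_add_div u (X - C β)
    rw [modByMonic_X_sub_C_eq_C_eval] at this
    rw [hU]; linear_combination -this
  have hGd : G.natDegree = g.natDegree - 1 := by
    rw [hG, natDegree_divByMonic _ (monic_X_sub_C β), natDegree_X_sub_C]
  have hGm : G.Monic := by
    rw [Monic, hG, leadingCoeff_divByMonic_X_sub_C]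
    · exact hg
    · rw [degree_eq_natDegree hg.ne_zero]; exact_mod_cast hd.ne'
  have hUd : U.natDegree < g.natDegree - 1 ∨ U = 0 := by
    by_cases h0 : u.natDegree = 0
    · right
      rw [hU, divByMonic_eq_zero_iff (monic_X_sub_C β), degree_X_sub_C]
      calc u.degree ≤ u.natDegree := degree_le_natDegree
        _ < 1 := by rw [h0]; norm_num
    · left
      rw [hU, natDegree_divByMonic _ (monic_X_sub_C β), natDegree_X_sub_C]
      have := natDegree_lt_natDegree (by rintro rfl; simp at h0) hu
      omega
  have hUc : U.coeff (g.natDegree - 1) = 0 := by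
    rcases hUd with h | h
    · exact coeff_eq_zero_of_natDegree_lt h
    · simp [h]
  have h3 : (u * G) %ₘ g = C (u.eval β) * G - C (g.eval β) * U := by
    have hlt : (C (u.eval β) * G - C (g.eval β) * U).degree < g.degree := by
      refine lt_of_le_of_lt (degree_sub_le _ _) (max_lt ?_ ?_)
      · rw [← smul_eq_C_mul]; refine lt_of_le_of_lt (degree_smul_le _ _) ?_
        apply degree_lt_degree; omega
      · rw [← smul_eq_C_mul]; refine lt_of_le_of_lt (degree_smul_le _ _) ?_
        rcases hUd with h | h
        · apply degree_lt_degree; omega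
        · rw [h, degree_zero, bot_lt_iff_ne_bot]
          simpa using hg.ne_zero
    refine (div_modByMonic_unique U _ hg ⟨?_, hlt⟩).2
    linear_combination U * h1 - G * h2
  rw [h3, coeff_sub, coeff_C_mul, coeff_C_mul, hUc, ← hGd, hGm.coeff_natDegree]
  ring

theorem resid_multi (u g : k[X]) (hg : g.Monic) (hu : u.degree < g.degree) (hd : 0 < g.natDegree)
    (s : Multiset k) : (∀ β ∈ s, g.eval β ≠ 0) →
    ∃ w : k[X], g ∣ (s.map (fun β => X - C β)).prod * w - derivative (s.map (fun β => X - C β)).prod ∧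
      ((u * w) %ₘ g).coeff (g.natDegree - 1) = - (s.map (fun β => u.eval β / g.eval β)).sum := by
  induction s using Multiset.induction with
  | empty => intro _; exact ⟨0, by simp, by simp⟩
  | cons β s ih =>
    intro h
    obtain ⟨w, hw1, hw2⟩ := ih (fun b hb => h b (Multiset.mem_cons_of_mem hb))
    have hβ := h β (Multiset.mem_cons_self _ _)
    set G := g /ₘ (X - C β) with hG
    have h1 : g = (X - C β) * G + C (g.eval β) := by
      have := modByMonic_add_div g (X - C β)
      rw [modByMonic_X_sub_C_eq_C_eval] at this
      rw [hG]; linear_combination -this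
    refine ⟨w - C (g.eval β)⁻¹ * G, ?_, ?_⟩
    · obtain ⟨t, ht⟩ := hw1
      rw [Multiset.map_cons, Multiset.prod_cons, derivative_mul, derivative_X_sub_C]
      set P := (s.map (fun β => X - C β)).prod
      have h2 : (C (g.eval β)⁻¹ * C (g.eval β) : k[X]) = 1 := by
        rw [← C_mul, inv_mul_cancel₀ hβ, C_1]
      refine ⟨(X - C β) * t - P * C (g.eval β)⁻¹, ?_⟩
      linear_combination (X - C β) * ht + P * C (g.eval β)⁻¹ * h1 + P * h2
    · have e : u * (w - C (g.eval β)⁻¹ * G) = u * w - (g.eval β)⁻¹ • (u * G) := by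
        rw [smul_eq_C_mul]; ring
      rw [e, sub_modByMonic, smul_modByMonic, coeff_sub, coeff_smul, hw2, resid_one u g hg hu β hβ hd,
        Multiset.map_cons, Multiset.sum_cons, smul_eq_mul]
      ring

theorem theta_congr (u g M h1 h2 : k[X]) (hg : g.Monic) (hu : u.degree < g.degree) (hd : 0 < g.natDegree)
    (hM : g ∣ M) (hM' : g ∣ derivative M) (hh1 : h1.Monic) (hh2 : h2.Monic)
    (hs1 : h1.Splits) (hs2 : h2.Splits) (hc1 : IsCoprime h1 g) (hc2 : IsCoprime h2 g)
    (hM12 : M ∣ h1 - h2) :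
    (h1.roots.map (fun β => u.eval β / g.eval β)).sum = (h2.roots.map (fun β => u.eval β / g.eval β)).sum := by
  have hnz : ∀ h : k[X], IsCoprime h g → h ≠ 0 → ∀ β ∈ h.roots, g.eval β ≠ 0 := by
    intro h hc h0 β hβ hgβ
    rw [mem_roots h0] at hβ
    obtain ⟨a, b, hab⟩ := hc
    have := congrArg (eval β) hab
    rw [eval_add, eval_mul, eval_mul, hgβ, hβ.eq_zero] at this
    simp at this
  obtain ⟨w1, hw1, e1⟩ := resid_multi u g hg hu hd h1.roots (hnz h1 hc1 hh1.ne_zero)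
  obtain ⟨w2, hw2, e2⟩ := resid_multi u g hg hu hd h2.roots (hnz h2 hc2 hh2.ne_zero)
  rw [← hs1.eq_prod_roots_of_monic hh1] at hw1
  rw [← hs2.eq_prod_roots_of_monic hh2] at hw2
  have hA : g ∣ h1 - h2 := hM.trans hM12
  have hB : g ∣ derivative h1 - derivative h2 := by
    obtain ⟨t, ht⟩ := hM12
    rw [← derivative_sub, ht, derivative_mul]
    exact dvd_add (hM'.mul_right _) (hM.mul_right _)
  have hC : g ∣ h1 * (w1 - w2) := by
    have : h1 * (w1 - w2) = (h1 * w1 - derivative h1) - (h2 * w2 - derivative h2)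
      + (derivative h1 - derivative h2) - (h1 - h2) * w2 := by ring
    rw [this]
    exact dvd_sub (dvd_add (dvd_sub hw1 hw2) hB) (hA.mul_right _)
  have hD : g ∣ w1 - w2 := (hc1.symm).dvd_of_dvd_mul_left hC
  have hE : (u * w1) %ₘ g = (u * w2) %ₘ g := by
    rw [← sub_eq_zero, ← sub_modByMonic, modByMonic_eq_zero_iff_dvd hg, ← mul_sub]
    exact hD.mul_left _
  rw [hE, e2] at e1
  exact (neg_injective e1).symm
end resid

section chars
variable {K k : Type} [Field K] [Fintype K] [Field k] [IsAlgClosed k] [Algebra K k] [Algebra.IsAlgebraic K k]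

variable (k) in
/-- sum of `u/g` over the roots -/
noncomputable def theta (u g h : K[X]) : k :=
  ((h.map (algebraMap K k)).roots.map (fun β => (u.map (algebraMap K k)).eval β / (g.map (algebraMap K k)).eval β)).sum

/-- absolute trace polynomial -/
noncomputable def Tp (p N : ℕ) (z : k) : k := ∑ i ∈ Finset.range N, z ^ p ^ i

open Classical in
/-- the character -/
noncomputable def chi (Ψ : AddChar k ℂ) (p N : ℕ) (u g h : K[X]) : ℂ :=
  if IsCoprime h g then Ψ (Tp p N (theta k u g h)) else 0

theorem Tp_add (p N : ℕ) [Fact p.Prime] [CharP k p] (x y : k) : Tp p N (x + y) = Tp p N x + Tp p N y := by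
  simp only [Tp, add_pow_char_pow, Finset.sum_add_distrib]

theorem Tp_zero (p N : ℕ) [hp : Fact p.Prime] : Tp p N (0 : k) = 0 := by
  simp [Tp, hp.out.ne_zero]

theorem theta_mul (u g a b : K[X]) (ha : a.Monic) (hb : b.Monic) :
    theta k u g (a * b) = theta k u g a + theta k u g b := by
  rw [theta, Polynomial.map_mul, roots_mul, Multiset.map_add, Multiset.sum_add]; · rfl
  exact mul_ne_zero (Polynomial.map_ne_zero ha.ne_zero) (Polynomial.map_ne_zero hb.ne_zero)

theorem theta_one (u g : K[X]) : theta k u g 1 = 0 := by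
  simp [theta]

theorem chi_mul (Ψ : AddChar k ℂ) (p N : ℕ) [Fact p.Prime] [CharP k p] (u g a b : K[X]) (ha : a.Monic) (hb : b.Monic) :
    chi Ψ p N u g (a * b) = chi Ψ p N u g a * chi Ψ p N u g b := by
  unfold chi
  by_cases h1 : IsCoprime a g
  · by_cases h2 : IsCoprime b g
    · rw [if_pos (h1.mul_left h2), if_pos h1, if_pos h2, theta_mul u g a b ha hb, Tp_add, AddChar.map_add_eq_mul]
    · rw [if_neg h2, if_neg (fun h => h2 h.of_mul_left_right), mul_zero]
  · rw [if_neg h1, if_neg (fun h => h1 h.of_mul_left_left), zero_mul]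

theorem chi_one (Ψ : AddChar k ℂ) (p N : ℕ) [Fact p.Prime] (u g : K[X]) :
    chi Ψ p N u g 1 = 1 := by
  rw [chi, if_pos isCoprime_one_left, theta_one, Tp_zero, AddChar.map_zero_eq_one]

theorem dvd_deriv_rad [DecidableEq K] (g M : K[X]) (hM : M = g * UniqueFactorizationMonoid.radical g) : g ∣ derivative M := by
  rw [hM, derivative_mul]
  apply dvd_add _ (dvd_mul_right _ _)
  have h1 := divRadical_dvd_derivative g
  have h2 : UniqueFactorizationMonoid.radical g * EuclideanDomain.divRadical g = g := EuclideanDomain.radical_mul_divRadical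
  obtain ⟨t, ht⟩ := h1
  rw [ht]
  refine ⟨t, ?_⟩
  conv_rhs => rw [← h2]
  ring

theorem chi_congr (Ψ : AddChar k ℂ) (p N : ℕ) (u g M a b : K[X]) (hg : g.Monic)
    (hu : u.degree < g.degree) (hd : 0 < g.natDegree)
    (hgM : g ∣ M) (hdd : g ∣ derivative M) (ha : a.Monic) (hb : b.Monic) (hab : M ∣ a - b) :
    chi Ψ p N u g a = chi Ψ p N u g b := by
  have hiff : IsCoprime a g ↔ IsCoprime b g := by
    obtain ⟨t, ht⟩ := hgM.trans hab
    have : a = b + g * t := by linear_combination ht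
    rw [this]
    exact IsCoprime.add_mul_left_left_iff
  unfold chi
  by_cases h1 : IsCoprime a g
  · have h2 := hiff.1 h1
    rw [if_pos h1, if_pos h2]
    congr 2
    unfold theta
    let φ := mapRingHom (algebraMap K k)
    apply theta_congr (u.map (algebraMap K k)) (g.map (algebraMap K k)) (M.map (algebraMap K k))
    · exact hg.map _
    · rwa [degree_map, degree_map]
    · rwa [natDegree_map]
    · exact map_dvd φ hgM
    · rw [derivative_map]; exact map_dvd φ hdd
    · exact ha.map _
    · exact hb.map _
    · exact IsAlgClosed.splits _
    · exact IsAlgClosed.splits _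
    · exact h1.map φ
    · exact h2.map φ
    · have := map_dvd φ hab
      rwa [map_sub] at this
  · rw [if_neg h1, if_neg (fun h => h1 (hiff.2 h))]

theorem sum_vanish (Ψ : AddChar k ℂ) (p N : ℕ) [Fact p.Prime] [CharP k p] (u g M h0 : K[X]) (hg : g.Monic)
    (hu : u.degree < g.degree) (hd : 0 < g.natDegree) (hMm : M.Monic)
    (hgM : g ∣ M) (hdd : g ∣ derivative M) (hMg : M ∣ g ^ 2) (hh0 : h0.Monic) (hc : IsCoprime h0 g)
    (hne : chi Ψ p N u g h0 ≠ 1) (n : ℕ) (hn : M.natDegree ≤ n) :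
    ∑ h ∈ Mon K n, chi Ψ p N u g h = 0 := by
  classical
  have hcM : IsCoprime M h0 := (hc.pow_right (n := 2)).symm.of_isCoprime_of_dvd_left hMg
  have hMd : 0 < M.natDegree := by
    have := natDegree_le_of_dvd hgM hMm.ne_zero
    omega
  have hM1 : M ≠ 1 := by rintro rfl; simp at hMd
  let σ : K[X] → K[X] := fun h => M * (h /ₘ M) + (h0 * h) %ₘ M
  have hmaps : ∀ h ∈ Mon K n, σ h ∈ Mon K n := by
    intro h hh
    rw [mem_Mon] at hh ⊢
    have e1 := modByMonic_add_div h M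
    have e2 : σ h = h + ((h0 * h) %ₘ M - h %ₘ M) := by
      show M * (h /ₘ M) + (h0 * h) %ₘ M = _
      linear_combination e1
    have hlt : ((h0 * h) %ₘ M - h %ₘ M).degree < h.degree := by
      have hle : M.degree ≤ h.degree := by
        rw [degree_eq_natDegree hMm.ne_zero, degree_eq_natDegree hh.1.ne_zero, hh.2]
        exact_mod_cast hn
      refine lt_of_le_of_lt (degree_sub_le _ _) (max_lt ?_ ?_)
      · exact lt_of_lt_of_le (degree_modByMonic_lt _ hMm) hle
      · exact lt_of_lt_of_le (degree_modByMonic_lt _ hMm) hle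
    rw [e2]
    exact ⟨hh.1.add_of_left hlt, by rw [natDegree_add_eq_left_of_degree_lt hlt, hh.2]⟩
  have hcong : ∀ h, M ∣ σ h - h0 * h := by
    intro h
    have e1 := modByMonic_add_div (h0 * h) M
    refine ⟨h /ₘ M - (h0 * h) /ₘ M, ?_⟩
    show M * (h /ₘ M) + (h0 * h) %ₘ M - _ = _
    linear_combination e1
  have hinj : Set.InjOn σ (Mon K n) := by
    intro a ha b hb hab
    have h1 : a /ₘ M = b /ₘ M := by
      have hA := (div_modByMonic_unique (f := σ a) (a /ₘ M) ((h0 * a) %ₘ M) hMm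
        ⟨by show _ = M * (a /ₘ M) + (h0 * a) %ₘ M; ring, degree_modByMonic_lt _ hMm⟩).1
      have hB := (div_modByMonic_unique (f := σ b) (b /ₘ M) ((h0 * b) %ₘ M) hMm
        ⟨by show _ = M * (b /ₘ M) + (h0 * b) %ₘ M; ring, degree_modByMonic_lt _ hMm⟩).1
      rw [← hA, ← hB, hab]
    have h2 : M ∣ a - b := by
      have h3 : M ∣ h0 * (a - b) := by
        have := dvd_sub (hcong b) (hcong a)
        have e : σ b - h0 * b - (σ a - h0 * a) = h0 * (a - b) := by rw [hab]; ring
        rwa [e] at this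
      exact hcM.dvd_of_dvd_mul_left h3
    have h4 : a %ₘ M = b %ₘ M := by
      rwa [← sub_eq_zero, ← sub_modByMonic, modByMonic_eq_zero_iff_dvd hMm]
    rw [← modByMonic_add_div a M, ← modByMonic_add_div b M, h1, h4]
  have himg : (Mon K n).image σ = Mon K n := by
    apply Finset.eq_of_subset_of_card_le
    · intro h hh
      obtain ⟨a, ha, rfl⟩ := Finset.mem_image.1 hh
      exact hmaps a ha
    · rw [Finset.card_image_of_injOn hinj]
  have hfin : ∑ h ∈ Mon K n, chi Ψ p N u g h = chi Ψ p N u g h0 * ∑ h ∈ Mon K n, chi Ψ p N u g h := by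
    conv_lhs => rw [← himg]
    rw [Finset.sum_image hinj, Finset.mul_sum]
    apply Finset.sum_congr rfl
    intro h hh
    have h1 := hmaps h hh
    rw [mem_Mon] at hh h1
    rw [← chi_mul Ψ p N u g h0 h hh0 hh.1]
    exact chi_congr Ψ p N u g M _ _ hg hu hd hgM hdd h1.1 (hh0.mul hh.1) (hcong h)
  by_contra h
  exact hne (mul_right_cancel₀ h (by rw [one_mul]; exact hfin.symm))

theorem eval_frob (P : K[X]) (y : k) (i : ℕ) :
    (P.map (algebraMap K k)).eval (y ^ Fintype.card K ^ i) = ((P.map (algebraMap K k)).eval y) ^ Fintype.card K ^ i := by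
  induction i with
  | zero => simp
  | succ i ih =>
    rw [pow_succ, pow_mul, pow_mul, ← ih, eval_map_algebraMap, eval_map_algebraMap]
    exact aeval_algHom_apply (FiniteField.frobeniusAlgHom K k) _ _

theorem sum_periodic (e c : ℕ) (F : ℕ → k) (hF : ∀ i, F (e + i) = F i) :
    ∑ i ∈ Finset.range (e * c), F i = c • ∑ i ∈ Finset.range e, F i := by
  induction c with
  | zero => simp
  | succ c ih =>
    have h : e * (c + 1) = e + e * c := by ring
    rw [h, Finset.sum_range_add, add_comm, add_smul, one_smul, ← ih]
    congr 1
    exact Finset.sum_congr rfl (fun i _ => hF i)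

theorem sum_block (n c : ℕ) (F : ℕ → k) :
    ∑ i ∈ Finset.range c, ∑ l ∈ Finset.range n, F (n * i + l) = ∑ i ∈ Finset.range (n * c), F i := by
  induction c with
  | zero => simp
  | succ c ih =>
    rw [Finset.sum_range_succ, ih, Nat.mul_succ, Finset.sum_range_add]

theorem Tp_theta_cK (p N : ℕ) [Fact p.Prime] [CharP k p] (hQ : Fintype.card K = p ^ N) (u g : K[X]) (n : ℕ) (y : k)
    (hy : y ∈ Xset K k n) :
    Tp p N (theta k u g (cK K n y)) = ∑ i ∈ Finset.range (N * n),
      ((u.map (algebraMap K k)).eval y / (g.map (algebraMap K k)).eval y) ^ p ^ i := by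
  rw [mem_Xset, frob_period] at hy
  set f := ((u.map (algebraMap K k)).eval y / (g.map (algebraMap K k)).eval y) with hf
  have h1 : theta k u g (cK K n y) = ∑ i ∈ Finset.range n, f ^ Fintype.card K ^ i := by
    obtain ⟨c, hc⟩ := hy.2
    have hpos : 0 < (minpoly K y).natDegree := minpoly.natDegree_pos (Algebra.IsIntegral.isIntegral y)
    rw [theta, cK, Polynomial.map_pow, roots_pow, minpoly_roots, Multiset.map_nsmul, Multiset.sum_nsmul,
      Multiset.map_map, hc, Nat.mul_div_cancel_left _ hpos, sum_periodic]
    · congr 1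
      show (Multiset.map _ (Multiset.range _)).sum = (Multiset.map _ (Multiset.range _)).sum
      congr 1
      apply Multiset.map_congr rfl
      intro i _
      simp only [Function.comp, eval_frob, hf, div_pow]
    · intro i
      rw [pow_add, pow_mul]
      congr 1
      rw [hf, div_pow, ← eval_frob, ← eval_frob, (frob_period (K := K) y _).2 dvd_rfl]
  rw [h1, Tp, ← sum_block]
  simp_rw [sum_pow_char_pow]
  rw [Finset.sum_comm]
  apply Finset.sum_congr rfl
  intro i _
  apply Finset.sum_congr rfl
  intro l _
  rw [← pow_mul, hQ, pow_add, pow_mul p N i]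

theorem coprime_cK (g : K[X]) (n : ℕ) (y : k) (hy : y ∈ Xset K k n) :
    IsCoprime (cK K n y) g ↔ (g.map (algebraMap K k)).eval y ≠ 0 := by
  have hd := cK_natDegree n y hy
  rw [mem_Xset] at hy
  have hi : IsIntegral K y := Algebra.IsIntegral.isIntegral y
  unfold cK at hd ⊢
  rw [natDegree_pow] at hd
  rw [IsCoprime.pow_left_iff, (minpoly.irreducible hi).coprime_iff_not_dvd, minpoly.dvd_iff, eval_map_algebraMap]
  rw [Nat.pos_iff_ne_zero]
  intro h
  rw [h] at hd
  omega
end chars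

section final4
variable {K k : Type} [Field K] [Fintype K] [Field k] [IsAlgClosed k] [Algebra K k] [Algebra.IsAlgebraic K k]

theorem exists_Psi (p : ℕ) [Fact p.Prime] [CharP k p] :
    ∃ Ψ : AddChar k ℂ, ∀ c : ZMod p, Ψ (ZMod.castHom (dvd_refl p) k c) = ZMod.stdAddChar c := by
  let _ := ZMod.algebra k p
  obtain ⟨l, hl⟩ := LinearMap.exists_leftInverse_of_injective (Algebra.linearMap (ZMod p) k)
    (LinearMap.ker_eq_bot.2 (algebraMap (ZMod p) k).injective)
  refine ⟨(ZMod.stdAddChar (N := p)).compAddMonoidHom l.toAddMonoidHom, fun c => ?_⟩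
  have := LinearMap.congr_fun hl c
  rw [AddChar.compAddMonoidHom_apply]
  congr 1

theorem char_sum_bound (p : ℕ) [Fact p.Prime] (Y : Finset k) (t : k → ZMod p) (U : ℕ)
    (h : ∀ c, (Y.filter (fun y => t y = c)).card ≤ U) :
    ‖∑ y ∈ Y, (ZMod.stdAddChar (t y) : ℂ)‖ ≤ p * U - Y.card := by
  have h1 : ∑ y ∈ Y, (ZMod.stdAddChar (t y) : ℂ) =
      ∑ c : ZMod p, ((Y.filter (fun y => t y = c)).card : ℂ) * ZMod.stdAddChar c := by
    rw [← Finset.sum_fiberwise Y t]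
    apply Finset.sum_congr rfl
    intro c _
    rw [← nsmul_eq_mul, ← Finset.sum_const]
    apply Finset.sum_congr rfl
    intro y hy
    rw [(Finset.mem_filter.1 hy).2]
  have h0 : ∑ c : ZMod p, (ZMod.stdAddChar c : ℂ) = 0 := by
    apply AddChar.sum_eq_zero_of_ne_one
    have := ZMod.isPrimitive_stdAddChar p (one_ne_zero)
    rwa [AddChar.mulShift_one] at this
  have h2 : ∑ y ∈ Y, (ZMod.stdAddChar (t y) : ℂ) =
      ∑ c : ZMod p, (((Y.filter (fun y => t y = c)).card : ℂ) - U) * ZMod.stdAddChar c := by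
    simp_rw [sub_mul]
    rw [Finset.sum_sub_distrib, ← Finset.mul_sum, h0, h1]; simp
  rw [h2]
  refine (norm_sum_le _ _).trans ?_
  have h3 : ∀ c : ZMod p, ‖(((Y.filter (fun y => t y = c)).card : ℂ) - U) * ZMod.stdAddChar c‖ ≤
      (U : ℝ) - (Y.filter (fun y => t y = c)).card := by
    intro c
    rw [norm_mul, AddChar.norm_apply, mul_one]
    have e : (((Y.filter (fun y => t y = c)).card : ℂ) - U) =
      ((((Y.filter (fun y => t y = c)).card : ℝ) - U : ℝ) : ℂ) := by push_cast; rfl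
    rw [e, Complex.norm_real, Real.norm_eq_abs, abs_sub_comm, abs_of_nonneg]
    rw [sub_nonneg]
    exact_mod_cast h c
  refine (Finset.sum_le_sum (fun c _ => h3 c)).trans ?_
  rw [Finset.sum_sub_distrib, Finset.sum_const, Finset.card_univ, ZMod.card, nsmul_eq_mul,
    ← Nat.cast_sum, ← Finset.card_eq_sum_card_fiberwise (fun _ _ => Finset.mem_univ _)]

theorem S_eq (p N : ℕ) [Fact p.Prime] [CharP k p] (hQ : Fintype.card K = p ^ N)
    (Ψ : AddChar k ℂ) (u g : K[X]) (n : ℕ) [DecidableEq k] :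
    ∑ y ∈ Xset K k n, chi Ψ p N u g (cK K n y) =
    ∑ y ∈ (Xset K k n).filter (fun y => (g.map (algebraMap K k)).eval y ≠ 0),
      Ψ (∑ i ∈ Finset.range (N * n),
      ((u.map (algebraMap K k)).eval y / (g.map (algebraMap K k)).eval y) ^ p ^ i) := by
  rw [Finset.sum_filter]
  apply Finset.sum_congr rfl
  intro y hy
  unfold chi
  rw [Tp_theta_cK p N hQ u g n y hy]
  by_cases h : (g.map (algebraMap K k)).eval y ≠ 0
  · rw [if_pos h, if_pos ((coprime_cK g n y hy).2 h)]
  · rw [if_neg h, if_neg (fun h' => h ((coprime_cK g n y hy).1 h'))]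

theorem mem_prime_field (p : ℕ) [hp : Fact p.Prime] [CharP k p] (z : k) (hz : z ^ p = z) :
    ∃ c : ZMod p, z = ZMod.castHom (dvd_refl p) k c := by
  have := (Subfield.mem_bot_iff_pow_eq_self (F := k) (p := p)).2 hz
  rw [← ZMod.fieldRange_castHom_eq_bot p] at this
  obtain ⟨c, hc⟩ := this
  exact ⟨c, hc.symm⟩

theorem card_nonzero [DecidableEq k] (g : K[X]) (hg : g ≠ 0) (n : ℕ) (hn : n ≠ 0) :
    (Fintype.card K) ^ n ≤ ((Xset K k n).filter (fun y => (g.map (algebraMap K k)).eval y ≠ 0)).card + g.natDegree := by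
  have hne : g.map (algebraMap K k) ≠ 0 := Polynomial.map_ne_zero hg
  rw [← card_Xset (K := K) (k := k) n hn, ← Finset.card_filter_add_card_filter_not (fun y => (g.map (algebraMap K k)).eval y ≠ 0)]
  gcongr
  calc _ ≤ (g.map (algebraMap K k)).roots.toFinset.card := by
        apply Finset.card_le_card
        intro y hy
        simp only [Finset.mem_filter, not_not] at hy
        rw [Multiset.mem_toFinset, mem_roots hne]
        exact hy.2
    _ ≤ _ := Multiset.toFinset_card_le _
    _ ≤ _ := card_roots' _
    _ = _ := natDegree_map _

theorem S_bound (p N : ℕ) [hp : Fact p.Prime] [CharP k p] (hQ : Fintype.card K = p ^ N) (hN : 2 ≤ N)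
    (Ψ : AddChar k ℂ) (hΨ : ∀ c : ZMod p, Ψ (ZMod.castHom (dvd_refl p) k c) = ZMod.stdAddChar c)
    (u g : K[X]) (hg0 : g ≠ 0) (α : k) (l : ℕ) (hl : ¬ p ∣ l) (g' : k[X])
    (hg : g.map (algebraMap K k) = (X - C α) ^ l * g')
    (hg' : g'.eval α ≠ 0) (hu : (u.map (algebraMap K k)).eval α ≠ 0) (hd : u.natDegree ≤ g.natDegree) (n : ℕ) :
    ‖∑ y ∈ Xset K k n, chi Ψ p N u g (cK K n y)‖ ≤
      ((3 * g.natDegree + 5) * p ^ 2 + g.natDegree : ℕ) * (Real.sqrt (Fintype.card K)) ^ n := by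
  classical
  rcases eq_or_ne n 0 with rfl | hn
  · rw [Xset_zero]; simp; positivity
  set L := N * n with hL
  have hL2 : 2 ≤ L := by
    calc 2 ≤ N * 1 := by omega
      _ ≤ N * n := Nat.mul_le_mul_left _ (by omega)
  obtain ⟨a, b, hab, hba, hLab⟩ : ∃ a b : ℕ, a ≤ b ∧ b ≤ a + 1 ∧ L = a + 1 + (b + 1) :=
    ⟨(L - 2) / 2, L - 2 - (L - 2) / 2, by omega, by omega, by omega⟩
  have hQn : (Fintype.card K) ^ n = p ^ L := by rw [hQ, ← pow_mul]
  set uk := u.map (algebraMap K k)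
  set gk := g.map (algebraMap K k)
  set E := 3 * g.natDegree + 5 with hE
  rw [S_eq p N hQ Ψ u g n]
  set Y := (Xset K k n).filter (fun y => gk.eval y ≠ 0) with hY
  have hYc := card_nonzero (k := k) g hg0 n hn
  set t : k → k := fun y => ∑ i ∈ Finset.range L, (uk.eval y / gk.eval y) ^ p ^ i with ht
  have htp : ∀ y ∈ Y, ∃ c : ZMod p, t y = ZMod.castHom (dvd_refl p) k c := by
    intro y hy
    apply mem_prime_field
    rw [hY, Finset.mem_filter, mem_Xset] at hy
    simp only [ht]
    rw [sum_pow_char]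
    have h1 : ∀ i, ((uk.eval y / gk.eval y) ^ p ^ i) ^ p = (uk.eval y / gk.eval y) ^ p ^ (i + 1) := by
      intro i; rw [← pow_mul, pow_succ]
    simp_rw [h1]
    have h2 : (uk.eval y / gk.eval y) ^ p ^ L = (uk.eval y / gk.eval y) := by
      rw [← hQn, div_pow, ← eval_frob, ← eval_frob, hy.1.2]
    have h3 := Finset.sum_range_succ (fun i => (uk.eval y / gk.eval y) ^ p ^ i) L
    rw [Finset.sum_range_succ'] at h3
    simp only [h2, pow_zero, pow_one] at h3
    exact add_right_cancel h3
  choose! t' ht' using htp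
  have hsum : ∑ y ∈ Y, Ψ (∑ i ∈ Finset.range L, (uk.eval y / gk.eval y) ^ p ^ i) =
      ∑ y ∈ Y, (ZMod.stdAddChar (t' y) : ℂ) := by
    apply Finset.sum_congr rfl
    intro y hy
    rw [← hΨ, ← ht' y hy]
  rw [hsum]
  refine (char_sum_bound p Y t' (p ^ (a + b + 1) + E * p ^ (b + 1)) ?_).trans ?_
  · intro c
    have h1 := stepanov p uk gk α l hl g' hg hg' hu (by rw [natDegree_map, natDegree_map]; exact hd) a b hab
      (ZMod.castHom (dvd_refl p) k c) (Y.filter (fun y => t' y = c)) ?_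
    · rwa [natDegree_map] at h1
    · intro x hx
      rw [Finset.mem_filter] at hx
      have h2 := ht' x hx.1
      rw [hx.2] at h2
      have h3 := hx.1
      rw [hY, Finset.mem_filter, mem_Xset] at h3
      rw [← hLab]
      refine ⟨by rw [← hQn]; exact h3.1.2, h3.2, h2⟩
  · have hp1 : (1 : ℝ) ≤ p := by exact_mod_cast hp.out.one_lt.le
    set ρ := Real.sqrt (Fintype.card K) with hρ
    have hρ1 : 1 ≤ ρ := by
      rw [hρ, Real.one_le_sqrt]; exact_mod_cast Fintype.card_pos
    have hρn1 : 1 ≤ ρ ^ n := one_le_pow₀ hρ1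
    have hρ2 : (ρ ^ n) ^ 2 = (p : ℝ) ^ L := by
      rw [← pow_mul, mul_comm n 2, pow_mul, hρ, Real.sq_sqrt (by positivity)]
      exact_mod_cast hQn
    have hb : (p : ℝ) ^ (b + 1) ≤ p * ρ ^ n := by
      apply le_of_sq_le_sq _ (by positivity)
      rw [mul_pow, hρ2, ← pow_mul, ← pow_add]
      apply pow_le_pow_right₀ hp1
      omega
    have hYc' : (p : ℝ) ^ L ≤ Y.card + g.natDegree := by
      rw [hQn] at hYc
      exact_mod_cast hYc
    have hpL : (p : ℝ) ^ L = p * p ^ (a + b + 1) := by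
      rw [hLab, ← pow_succ']; congr 1; ring
    push_cast
    have hEb : (E : ℝ) * p * p ^ (b + 1) ≤ E * p * (p * ρ ^ n) := by gcongr
    have hgd : (g.natDegree : ℝ) ≤ g.natDegree * ρ ^ n := le_mul_of_one_le_right (by positivity) hρn1
    rw [hE] at hEb ⊢
    push_cast at hEb ⊢
    nlinarith

theorem weil_bound (p N : ℕ) [hp : Fact p.Prime] [CharP k p] (hQ : Fintype.card K = p ^ N) (hN : 2 ≤ N)
    (u g M : K[X]) (hgm : g.Monic) (α : k) (l : ℕ) (hl : ¬ p ∣ l) (g' : k[X])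
    (hg : g.map (algebraMap K k) = (X - C α) ^ l * g')
    (hg' : g'.eval α ≠ 0) (hu : (u.map (algebraMap K k)).eval α ≠ 0)
    (hug : u.degree < g.degree) (hgd : 0 < g.natDegree) (hMm : M.Monic)
    (hgM : g ∣ M) (hdd : g ∣ derivative M) (hMg : M ∣ g ^ 2)
    (hnz : ∀ x : K, g.eval x ≠ 0)
    (htr : ∀ x : K, ∑ i ∈ Finset.range N, (u.eval x / g.eval x) ^ p ^ i = 0) :
    (Fintype.card K : ℝ) ≤ (M.natDegree - 1 : ℕ) * Real.sqrt (Fintype.card K) := by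
  classical
  obtain ⟨Ψ, hΨ⟩ := exists_Psi (k := k) p
  have hd : u.natDegree ≤ g.natDegree := natDegree_le_natDegree hug.le
  have hS := S_bound p N hQ hN Ψ hΨ u g hgm.ne_zero α l hl g' hg hg' hu hd
  set B : ℕ := (3 * g.natDegree + 5) * p ^ 2 + g.natDegree
  set ρ := Real.sqrt (Fintype.card K) with hρ
  have hρ1 : 1 < ρ := by
    rw [hρ, Real.lt_sqrt (by norm_num)]; 
    have := Fintype.one_lt_card (α := K)
    norm_num
    exact_mod_cast this
  have hρ2 : ρ ^ 2 = Fintype.card K := by rw [hρ, Real.sq_sqrt (by positivity)]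
  have hMd : 0 < M.natDegree := by
    have := natDegree_le_of_dvd hgM hMm.ne_zero
    omega
  -- nontriviality
  have hnt : ∃ h0 : K[X], h0.Monic ∧ IsCoprime h0 g ∧ chi Ψ p N u g h0 ≠ 1 := by
    by_contra hcon
    push Not at hcon
    have key : ∀ n : ℕ, n ≠ 0 → ρ ^ n ≤ B + g.natDegree := by
      intro n hn
      have h1 : ∑ y ∈ Xset K k n, chi Ψ p N u g (cK K n y) =
          (((Xset K k n).filter (fun y => (g.map (algebraMap K k)).eval y ≠ 0)).card : ℂ) := by
        rw [Finset.card_filter, Nat.cast_sum]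
        apply Finset.sum_congr rfl
        intro y hy
        by_cases h : (g.map (algebraMap K k)).eval y ≠ 0
        · rw [if_pos h, hcon _ (cK_monic n y) ((coprime_cK g n y hy).2 h)]; simp
        · rw [if_neg h, chi, if_neg (fun h' => h ((coprime_cK g n y hy).1 h'))]; simp
      have h2 := hS n
      rw [h1, Complex.norm_natCast] at h2
      have h3 := card_nonzero (k := k) g hgm.ne_zero n hn
      have h4 : (ρ ^ n) ^ 2 ≤ B * ρ ^ n + g.natDegree := by
        rw [← pow_mul, mul_comm n 2, pow_mul, hρ2]
        have h5 : ((Fintype.card K : ℝ)) ^ n ≤ (((Xset K k n).filter (fun y => (g.map (algebraMap K k)).eval y ≠ 0)).card : ℝ) + g.natDegree := by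
          exact_mod_cast h3
        linarith
      have h6 : 1 ≤ ρ ^ n := one_le_pow₀ hρ1.le
      have h7 : (0 : ℝ) ≤ g.natDegree := by positivity
      by_contra h8
      push Not at h8
      nlinarith
    obtain ⟨n, hn⟩ := pow_unbounded_of_one_lt ((B : ℝ) + g.natDegree) hρ1
    have h1 := key (n + 1) (by omega)
    have h2 : ρ ^ n ≤ ρ ^ (n + 1) := pow_le_pow_right₀ hρ1.le (by omega)
    linarith
  obtain ⟨h0, hh0, hc, hne⟩ := hnt
  have h00 : ∑ h ∈ Mon K 0, chi Ψ p N u g h = 1 := by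
    have : Mon K 0 = {1} := by
      ext h
      rw [mem_Mon, Finset.mem_singleton]
      constructor
      · rintro ⟨h1, h2⟩; exact h1.natDegree_eq_zero.1 h2
      · rintro rfl; exact ⟨monic_one, natDegree_one⟩
    rw [this, Finset.sum_singleton, chi_one]
  have hpsb := power_sum_bound (fun n => ∑ h ∈ Mon K n, chi Ψ p N u g h)
    (fun n => ∑ y ∈ Xset K k n, chi Ψ p N u g (cK K n y)) (M.natDegree - 1) ?_ ?_ ?_ B ρ (by linarith) hS
  · have hrec := euler_rec k (chi Ψ p N u g) (chi_mul Ψ p N u g) 1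
    rw [Finset.Nat.sum_antidiagonal_eq_sum_range_succ (fun i j => (∑ y ∈ Xset K k i, chi Ψ p N u g (cK K i y)) * ∑ h ∈ Mon K j, chi Ψ p N u g h)] at hrec
    have hS1 : ∑ y ∈ Xset K k 1, chi Ψ p N u g (cK K 1 y) = Fintype.card K := by
      have h1 : ∀ y ∈ Xset K k 1, chi Ψ p N u g (cK K 1 y) = 1 := by
        intro y hy
        have hy' := hy
        rw [mem_Xset, frob_period, Nat.dvd_one] at hy'
        obtain ⟨x, rfl⟩ := (minpoly.natDegree_eq_one_iff).1 hy'.2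
        have e : ∀ P : K[X], (P.map (algebraMap K k)).eval (algebraMap K k x) = algebraMap K k (P.eval x) := by
          intro P; rw [eval_map_apply]
        rw [chi, if_pos, Tp_theta_cK p N hQ u g 1 _ hy, mul_one]
        · rw [e, e, ← map_div₀]
          simp_rw [← map_pow]
          rw [← map_sum, htr x, map_zero, AddChar.map_zero_eq_one]
        · rw [coprime_cK g 1 _ hy, e]
          simpa using hnz x
      rw [Finset.sum_congr rfl h1, Finset.sum_const, card_Xset _ one_ne_zero]
      simp
    rw [Finset.sum_range_succ, Finset.sum_range_one, Xset_zero, hS1, h00] at hrec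
    simp at hrec
    rw [hrec, Complex.norm_natCast] at hpsb
    exact hpsb
  · exact h00
  · intro n hn
    exact sum_vanish Ψ p N u g M h0 hgm hug hgd hMm hgM hdd hMg hh0 hc hne n (by omega)
  · intro n
    exact euler_rec k (chi Ψ p N u g) (chi_mul Ψ p N u g) n
end final4

section artin
variable {K : Type} [Field K] [Fintype K]

theorem dvd_deriv_rad' [DecidableEq K] (g R : K[X]) (hR : UniqueFactorizationMonoid.radical g ∣ R) :
    g ∣ derivative (g * R) := by
  rw [derivative_mul]
  apply dvd_add _ (dvd_mul_right _ _)
  obtain ⟨t, ht⟩ := divRadical_dvd_derivative g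
  obtain ⟨s, hs⟩ := hR
  have h2 : UniqueFactorizationMonoid.radical g * EuclideanDomain.divRadical g = g := EuclideanDomain.radical_mul_divRadical
  rw [ht, hs]
  refine ⟨t * s, ?_⟩
  conv_rhs => rw [← h2]
  ring

/-- the terminal case -/
theorem artin_terminal [DecidableEq K] (p N : ℕ) [hp : Fact p.Prime] [CharP K p] (hQ : Fintype.card K = p ^ N) (hN : 2 ≤ N)
    (u g R : K[X]) (hR0 : R ≠ 0) (hR : UniqueFactorizationMonoid.radical g ∣ R)
    (hnz : ∀ x : K, g.eval x ≠ 0) (hgd : 0 < g.natDegree) (hug : u.degree < g.degree)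
    (hb : ((g.natDegree + R.natDegree - 1 : ℕ) : ℝ) * Real.sqrt (Fintype.card K) < Fintype.card K)
    (htr : ∀ x : K, ∑ i ∈ Finset.range N, (u.eval x / g.eval x) ^ p ^ i = 0)
    (hcop : IsCoprime u g)
    (hmul : ∀ α : AlgebraicClosure K, aeval α g = 0 →
      ¬ p ∣ (g.map (algebraMap K (AlgebraicClosure K))).rootMultiplicity α) : False := by
  set k := AlgebraicClosure K
  have hg0 : g ≠ 0 := by rintro rfl; simp at hgd
  have : CharP k p := charP_of_injective_algebraMap (algebraMap K k).injective p
  have hlc : g.leadingCoeff ≠ 0 := leadingCoeff_ne_zero.2 hg0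
  set c : K := g.leadingCoeff⁻¹ with hc
  have hc0 : c ≠ 0 := inv_ne_zero hlc
  have hCu : IsUnit (C c : K[X]) := isUnit_C.2 (isUnit_iff_ne_zero.2 hc0)
  obtain ⟨α, hα⟩ := IsAlgClosed.exists_aeval_eq_zero k g (by
    rw [degree_eq_natDegree hg0]; exact_mod_cast hgd.ne')
  have hgk0 : g.map (algebraMap K k) ≠ 0 := Polynomial.map_ne_zero hg0
  obtain ⟨g', hg', hgd'⟩ := exists_eq_pow_rootMultiplicity_mul_and_not_dvd (g.map (algebraMap K k)) hgk0 α
  have hassoc : Associated (C c * g) g := associated_unit_mul_left g (C c) hCu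
  have hrad : UniqueFactorizationMonoid.radical (C c * g) = UniqueFactorizationMonoid.radical g :=
    UniqueFactorizationMonoid.radical_eq_of_associated hassoc
  set rd := normalize (UniqueFactorizationMonoid.radical g) with hrd
  have hrdass : Associated (UniqueFactorizationMonoid.radical g) rd := (normalize_associated _).symm
  have hrd0 : rd ≠ 0 := by
    rw [hrd, Ne, normalize_eq_zero]
    exact UniqueFactorizationMonoid.radical_ne_zero
  have hgm : (C c * g).Monic := by
    rw [mul_comm]; exact monic_mul_leadingCoeff_inv hg0
  have hrdm : rd.Monic := monic_normalize (by exact UniqueFactorizationMonoid.radical_ne_zero)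
  have hmain := weil_bound (k := k) p N hQ hN (C c * u) (C c * g) ((C c * g) * rd) hgm
    α _ (hmul α hα) (C (algebraMap K k c) * g') ?_ ?_ ?_ ?_ ?_ ?_ ?_ ?_ ?_ ?_ ?_
  · have h1 : ((C c * g) * rd).natDegree ≤ g.natDegree + R.natDegree := by
      rw [natDegree_mul hgm.ne_zero hrd0, natDegree_C_mul hc0]
      gcongr
      exact natDegree_le_of_dvd (hrdass.symm.dvd.trans hR) hR0
    have h2 : ((((C c * g) * rd).natDegree - 1 : ℕ) : ℝ) ≤ ((g.natDegree + R.natDegree - 1 : ℕ) : ℝ) := by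
      exact_mod_cast Nat.sub_le_sub_right h1 1
    have h3 := mul_le_mul_of_nonneg_right h2 (Real.sqrt_nonneg (Fintype.card K))
    linarith
  · rw [Polynomial.map_mul, map_C]
    linear_combination C (algebraMap K k c) * hg'
  · rw [eval_mul, eval_C]
    apply mul_ne_zero
    · simpa using hc0
    · rwa [dvd_iff_isRoot] at hgd'
  · rw [eval_map_algebraMap, map_mul, aeval_C]
    apply mul_ne_zero
    · simpa using hc0
    · intro h
      obtain ⟨a, b, hab⟩ := hcop
      have := congrArg (aeval α) hab
      simp [h, hα] at this
  · rwa [degree_C_mul hc0, degree_C_mul hc0]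
  · rwa [natDegree_C_mul hc0]
  · exact hgm.mul hrdm
  · exact dvd_mul_right _ _
  · apply dvd_deriv_rad'
    rw [hrad]
    exact hrdass.dvd
  · rw [pow_two]
    apply mul_dvd_mul_left
    refine (hrdass.symm.dvd.trans UniqueFactorizationMonoid.radical_dvd_self).trans hassoc.symm.dvd
  · intro x
    rw [eval_mul, eval_C]
    exact mul_ne_zero hc0 (hnz x)
  · intro x
    rw [eval_mul, eval_mul, eval_C, mul_div_mul_left _ _ hc0]
    exact htr x

theorem exists_frob_root (p : ℕ) [hp : Fact p.Prime] [CharP K p] (P u g : K[X]) (hP : Irreducible P) (hg : ¬ P ∣ g) :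
    ∃ c : K[X], c.degree < P.degree ∧ P ∣ u - c ^ p * g := by
  have : Fact (Irreducible P) := ⟨hP⟩
  have hP0 := hP.ne_zero
  have : CharP (AdjoinRoot P) p := charP_of_injective_algebraMap (algebraMap K (AdjoinRoot P)).injective p
  have : Module.Finite K (AdjoinRoot P) := (AdjoinRoot.powerBasis hP0).finite
  have : Finite (AdjoinRoot P) := Module.finite_of_finite K
  have hsurj : Function.Surjective (frobenius (AdjoinRoot P) p) :=
    Finite.surjective_of_injective (frobenius_inj _ p)
  obtain ⟨z, hz⟩ := hsurj (AdjoinRoot.mk P u / AdjoinRoot.mk P g)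
  obtain ⟨c, rfl⟩ := AdjoinRoot.mk_surjective z
  have hg' : AdjoinRoot.mk P g ≠ 0 := by rwa [Ne, AdjoinRoot.mk_eq_zero]
  refine ⟨c % P, EuclideanDomain.mod_lt c hP0, ?_⟩
  rw [← AdjoinRoot.mk_eq_zero, map_sub, map_mul, map_pow]
  have : AdjoinRoot.mk P (c % P) = AdjoinRoot.mk P c := by
    rw [AdjoinRoot.mk_eq_mk]
    refine ⟨-(c / P), ?_⟩
    have := EuclideanDomain.div_add_mod c P
    linear_combination this
  rw [this]
  rw [frobenius_def] at hz
  rw [hz]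
  field_simp
  ring

theorem tele (p N : ℕ) [hp : Fact p.Prime] [CharP K p] (hQ : Fintype.card K = p ^ N) (c : K) :
    ∑ i ∈ Finset.range N, (c ^ p - c) ^ p ^ i = 0 := by
  have h : ∀ i, (c ^ p - c) ^ p ^ i = c ^ p ^ (i + 1) - c ^ p ^ i := by
    intro i
    rw [sub_pow_char_pow, ← pow_mul, pow_succ']
  simp_rw [h]
  rw [Finset.sum_range_sub (fun i => c ^ p ^ i), ← hQ, FiniteField.pow_card]
  simp

theorem artin [DecidableEq K] (p N : ℕ) [hp : Fact p.Prime] [CharP K p] (hQ : Fintype.card K = p ^ N) (hN : 2 ≤ N)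
    (R : K[X]) (hR0 : R ≠ 0) (n : ℕ) : ∀ (u g : K[X]) (_ : g.natDegree = n) (_ : UniqueFactorizationMonoid.radical g ∣ R)
    (_ : ∀ x : K, g.eval x ≠ 0) (_ : u.degree < g.degree)
    (_ : ((g.natDegree + R.natDegree - 1 : ℕ) : ℝ) * Real.sqrt (Fintype.card K) < Fintype.card K)
    (_ : ∀ x : K, ∑ i ∈ Finset.range N, (u.eval x / g.eval x) ^ p ^ i = 0),
    ∃ h : RatFunc K, (algebraMap K[X] (RatFunc K) u) / (algebraMap K[X] (RatFunc K) g) = h ^ p - h := by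
  induction n using Nat.strong_induction_on with
  | _ n ih =>
  intro u g hgn hR hnz hug hb htr
  have hchar : CharP (RatFunc K) p := charP_of_injective_algebraMap (algebraMap K (RatFunc K)).injective p
  have hinj : ∀ a : K[X], a ≠ 0 → algebraMap K[X] (RatFunc K) a ≠ 0 := by
    intro a ha; exact RatFunc.algebraMap_ne_zero ha
  have hg0 : g ≠ 0 := by rintro rfl; simp at hug
  have hmono : ∀ g2 : K[X], g2 ∣ g → g2.natDegree < n →
      UniqueFactorizationMonoid.radical g2 ∣ R ∧ (∀ x : K, g2.eval x ≠ 0) ∧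
      ((g2.natDegree + R.natDegree - 1 : ℕ) : ℝ) * Real.sqrt (Fintype.card K) < Fintype.card K := by
    intro g2 h1 h2
    refine ⟨(UniqueFactorizationMonoid.radical_dvd_radical h1 hg0).trans hR, ?_, ?_⟩
    · intro x hx
      obtain ⟨t, rfl⟩ := h1
      apply hnz x
      rw [eval_mul, hx, zero_mul]
    · refine lt_of_le_of_lt ?_ hb
      apply mul_le_mul_of_nonneg_right _ (Real.sqrt_nonneg _)
      have : g2.natDegree + R.natDegree - 1 ≤ g.natDegree + R.natDegree - 1 := by omega
      exact_mod_cast this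
  by_cases hu0 : u = 0
  · refine ⟨0, ?_⟩
    rw [hu0]; simp [hp.out.ne_zero]
  by_cases hcop : IsCoprime u g
  swap
  · -- cancel the gcd
    obtain ⟨P, hP, ⟨u', hu'⟩, ⟨g', hg'⟩⟩ : ∃ P : K[X], Irreducible P ∧ P ∣ u ∧ P ∣ g := by
      by_contra hcon
      push Not at hcon
      apply hcop
      apply isCoprime_of_irreducible_dvd (by simp [hu0])
      intro z hz h1 h2
      exact hcon z hz h1 h2
    have hP0 := hP.ne_zero
    have hPd := hP.natDegree_pos
    have hg'0 : g' ≠ 0 := by rintro rfl; exact hg0 (by rw [hg', mul_zero])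
    have hlt : g'.natDegree < n := by
      rw [← hgn, hg', natDegree_mul hP0 hg'0]; omega
    obtain ⟨a1, a2, a3⟩ := hmono g' ⟨P, by rw [hg']; ring⟩ hlt
    have hih := ih _ hlt u' g' rfl a1 a2 ?_ a3 ?_
    · obtain ⟨h, hh⟩ := hih
      refine ⟨h, ?_⟩
      rw [← hh, hu', hg', map_mul, map_mul, mul_div_mul_left _ _ (hinj P hP0)]
    · rw [hu', hg', degree_mul, degree_mul] at hug
      exact lt_of_add_lt_add_left hug
    · intro x
      rw [← htr x]
      have hx := hnz x
      rw [hg', eval_mul] at hx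
      rw [hu', hg', eval_mul, eval_mul, mul_div_mul_left _ _ (left_ne_zero_of_mul hx)]
  by_cases hmul : ∀ α : AlgebraicClosure K, aeval α g = 0 →
      ¬ p ∣ (g.map (algebraMap K (AlgebraicClosure K))).rootMultiplicity α
  · exfalso
    refine artin_terminal p N hQ hN u g R hR0 hR hnz ?_ hug hb htr hcop hmul
    rw [Nat.pos_iff_ne_zero]
    intro h
    rw [degree_eq_natDegree hu0, degree_eq_natDegree hg0, h] at hug
    exact absurd hug (by simp)
  · push Not at hmul
    obtain ⟨α, hα, t, ht⟩ := hmul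
    set l := (g.map (algebraMap K (AlgebraicClosure K))).rootMultiplicity α with hl
    have hi : IsIntegral K α := Algebra.IsIntegral.isIntegral α
    set P := minpoly K α with hPdef
    have hP : Irreducible P := minpoly.irreducible hi
    have hP0 := hP.ne_zero
    have hPd := hP.natDegree_pos
    obtain ⟨g', hg'⟩ := (pow_minpoly_dvd α g hg0 l).2 le_rfl
    rw [← hPdef] at hg'
    have hPg' : ¬ P ∣ g' := by
      rintro ⟨s, hs⟩
      have h1 : P ^ (l + 1) ∣ g := ⟨s, by rw [hg', hs]; ring⟩
      have := (pow_minpoly_dvd α g hg0 (l + 1)).1 h1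
      omega
    have hg'0 : g' ≠ 0 := by rintro rfl; simp at hPg'
    have hl1 : 1 ≤ l := by
      have h1 : P ^ 1 ∣ g := by rw [pow_one]; exact minpoly.dvd K α hα
      exact (pow_minpoly_dvd α g hg0 1).1 h1
    have ht1 : 1 ≤ t := by
      by_contra h
      have : t = 0 := by omega
      simp [this] at ht; omega
    have htl : t + 1 ≤ l := by
      have := hp.out.two_le
      nlinarith
    obtain ⟨m, hm⟩ := Nat.exists_eq_add_of_le htl
    obtain ⟨c, hcd, w, hw⟩ := exists_frob_root p P u g' hP hPg'
    have hgdeg : g.natDegree = l * P.natDegree + g'.natDegree := by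
      rw [hg', natDegree_mul (pow_ne_zero _ hP0) hg'0, natDegree_pow]
    set g2 := P ^ (t + m) * g' with hg2
    set u2 := w + c * P ^ m * g' with hu2
    have hgg2 : g = P * g2 := by rw [hg', hg2, hm]; ring
    have hg20 : g2 ≠ 0 := mul_ne_zero (pow_ne_zero _ hP0) hg'0
    have hg2deg : g2.natDegree = (t + m) * P.natDegree + g'.natDegree := by
      rw [hg2, natDegree_mul (pow_ne_zero _ hP0) hg'0, natDegree_pow]
    have hlt : g2.natDegree < n := by
      rw [← hgn, hgg2, natDegree_mul hP0 hg20]; omega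
    obtain ⟨a1, a2, a3⟩ := hmono g2 ⟨P, by rw [hgg2]; ring⟩ hlt
    have hPx : ∀ x, P.eval x ≠ 0 := by
      intro x h
      apply hnz x
      rw [hgg2, eval_mul, h, zero_mul]
    have hg'x : ∀ x, g'.eval x ≠ 0 := by
      intro x h
      apply hnz x
      rw [hg', eval_mul, h, mul_zero]
    have hlp : l = p * t := ht
    have hcnd : c.natDegree < P.natDegree := by
      rcases eq_or_ne c 0 with h | h
      · rw [h, natDegree_zero]; exact hPd
      · exact natDegree_lt_natDegree h hcd
    have hih := ih _ hlt u2 g2 rfl a1 a2 ?_ a3 ?_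
    · obtain ⟨h, hh⟩ := hih
      refine ⟨h + algebraMap K[X] (RatFunc K) c / algebraMap K[X] (RatFunc K) P ^ t, ?_⟩
      rw [add_pow_char]
      have e : algebraMap K[X] (RatFunc K) u / algebraMap K[X] (RatFunc K) g = 
        algebraMap K[X] (RatFunc K) u2 / algebraMap K[X] (RatFunc K) g2 + ((algebraMap K[X] (RatFunc K) c / algebraMap K[X] (RatFunc K) P ^ t) ^ p - 
          algebraMap K[X] (RatFunc K) c / algebraMap K[X] (RatFunc K) P ^ t) := by
        have hP' := hinj P hP0
        have hg'' := hinj g' hg'0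
        have hu' : u = P * w + c ^ p * g' := by linear_combination hw
        rw [hg', hg2, hu2, hu', div_pow, ← pow_mul, mul_comm t p, ← hlp, hm]
        simp only [map_mul, map_add, map_pow]
        field_simp
        ring
      rw [e, hh]; ring
    · have hdPw : (P * w).degree < g.degree := by
        rw [← hw]
        refine lt_of_le_of_lt (degree_sub_le _ _) (max_lt hug ?_)
        apply degree_lt_degree
        have h1 : (c ^ p * g').natDegree ≤ p * c.natDegree + g'.natDegree :=
          natDegree_mul_le.trans (Nat.add_le_add_right natDegree_pow_le _)
        have h2 : p * c.natDegree < l * P.natDegree := by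
          rw [hlp, mul_assoc]
          apply Nat.mul_lt_mul_of_pos_left _ hp.out.pos
          nlinarith
        omega
      rw [hgg2, degree_mul, degree_mul] at hdPw
      refine lt_of_le_of_lt (degree_add_le _ _) (max_lt (lt_of_add_lt_add_left hdPw) ?_)
      apply degree_lt_degree
      have h1 : (c * P ^ m * g').natDegree ≤ c.natDegree + m * P.natDegree + g'.natDegree :=
        natDegree_mul_le.trans (Nat.add_le_add_right (natDegree_mul_le.trans (Nat.add_le_add_left natDegree_pow_le _)) _)
      have h2 : P.natDegree ≤ t * P.natDegree := Nat.le_mul_of_pos_left _ ht1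
      rw [hg2deg, add_mul]
      omega
    · intro x
      rw [← htr x]
      have e : u2.eval x / g2.eval x = u.eval x / g.eval x - ((c.eval x / P.eval x ^ t) ^ p - c.eval x / P.eval x ^ t) := by
        have hP' := hPx x
        have hg'' := hg'x x
        have hu' : u = P * w + c ^ p * g' := by linear_combination hw
        rw [hg', hg2, hu2, hu', div_pow, ← pow_mul, mul_comm t p, ← hlp, hm]
        simp only [eval_mul, eval_add, eval_pow]
        field_simp
        ring
      rw [e]
      simp_rw [sub_pow_char_pow]
      rw [Finset.sum_sub_distrib]
      have := tele p N hQ (c.eval x / P.eval x ^ t)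
      simp_rw [sub_pow_char_pow] at this
      rw [this, sub_zero]
end artin

section last

theorem sum_block' {k : Type} [Field k] (n c : ℕ) (F : ℕ → k) :
    ∑ i ∈ Finset.range c, ∑ l ∈ Finset.range n, F (n * i + l) = ∑ i ∈ Finset.range (n * c), F i := by
  induction c with
  | zero => simp
  | succ c ih =>
    rw [Finset.sum_range_succ, ih, Nat.mul_succ, Finset.sum_range_add]

theorem trace_conv (p r m : ℕ) [hp : Fact p.Prime] (F K : Type) [Field F] [Field K] [Algebra F K] [Fintype F] [Fintype K]
    [CharP K p]
    (hF : Fintype.card F = p ^ r) (hfr : Module.finrank F K = m) (a : F) (z : K)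
    (hz : Algebra.trace F K z = 0) :
    ∑ i ∈ Finset.range (r * m), (algebraMap F K a * z) ^ p ^ i = 0 := by
  have h1 := FiniteField.algebraMap_trace_eq_sum_pow F K z
  rw [hz, map_zero, hfr, Nat.card_eq_fintype_card, hF] at h1
  have h2 : ∑ i ∈ Finset.range m, (algebraMap F K a * z) ^ (p ^ r) ^ i = 0 := by
    have : ∀ i, (algebraMap F K a * z) ^ (p ^ r) ^ i = algebraMap F K a * z ^ (p ^ r) ^ i := by
      intro i
      rw [mul_pow, ← map_pow, ← hF, FiniteField.pow_card_pow]
    simp_rw [this]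
    rw [← Finset.mul_sum, ← h1, mul_zero]
  rw [← sum_block', Finset.sum_comm]
  apply Finset.sum_eq_zero
  intro l _
  have h3 : ∀ i, (algebraMap F K a * z) ^ p ^ (r * i + l) = ((algebraMap F K a * z) ^ (p ^ r) ^ i) ^ p ^ l := by
    intro i
    rw [← pow_mul, pow_add, pow_mul p r i]
  simp_rw [h3]
  rw [← sum_pow_char_pow, h2, zero_pow (pow_ne_zero _ hp.out.ne_zero)]

open Classical in
theorem unit_sum (p r j : ℕ) [hp : Fact p.Prime] (F : Type) [Field F] [Fintype F] (hF : Fintype.card F = p ^ r)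
    (hj1 : 1 ≤ j) (hj : j ≤ r) :
    ∑ a : Fˣ, (a : F) * ((a⁻¹ : Fˣ) : F) ^ p ^ j = if j = r then -1 else 0 := by
  have h1 : ∑ a : Fˣ, (a : F) * ((a⁻¹ : Fˣ) : F) ^ p ^ j = ∑ a : Fˣ, ((a ^ (p ^ j - 1) : Fˣ) : F) := by
    rw [← Equiv.sum_comp (Equiv.inv Fˣ)]
    apply Finset.sum_congr rfl
    intro a _
    have hpos : 0 < p ^ j := pow_pos hp.out.pos j
    obtain ⟨e, he⟩ := Nat.exists_eq_succ_of_ne_zero hpos.ne'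
    rw [he]
    simp [pow_succ]
    field_simp
  simp only [Units.val_pow_eq_pow_val] at h1
  rw [h1, FiniteField.sum_pow_units, hF]
  have hlt : 1 < p ^ j := Nat.one_lt_pow (by omega) hp.out.one_lt
  by_cases h : j = r
  · rw [if_pos h, if_pos (by rw [h])]
  · rw [if_neg h, if_neg]
    intro hd
    have := Nat.le_of_dvd (by omega) hd
    have h2 : p ^ j < p ^ r := Nat.pow_lt_pow_right hp.out.one_lt (by omega)
    omega

open Classical in
theorem combine (p r : ℕ) [hp : Fact p.Prime] (hr : 1 ≤ r) (F L : Type) [Field F] [Fintype F] [Field L]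
    [CharP L p] (A : F →+* L) (hF : Fintype.card F = p ^ r) (f : L)
    (h : ∀ a : Fˣ, ∃ h : L, A a * f = h ^ p - h) : ∃ b : L, f = b ^ p ^ r - b := by
  choose η hη using h
  set B : ℕ → L := fun i => ∑ a : Fˣ, A ((a⁻¹ : Fˣ) : F) ^ p ^ i * η a with hB
  have hstep : ∀ i, i + 1 ≤ r → B i ^ p = B (i + 1) + f * A (if i + 1 = r then -1 else 0) := by
    intro i hi
    rw [← unit_sum p r (i + 1) F hF (by omega) hi, map_sum]
    simp only [hB]
    rw [sum_pow_char, Finset.mul_sum, ← Finset.sum_add_distrib]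
    apply Finset.sum_congr rfl
    intro a _
    rw [mul_pow, ← pow_mul, ← pow_succ, map_mul, map_pow]
    linear_combination -(A ((a⁻¹ : Fˣ) : F) ^ p ^ (i + 1)) * hη a
  have hind : ∀ i, i < r → B 0 ^ p ^ i = B i := by
    intro i
    induction i with
    | zero => intro _; simp
    | succ i ih =>
      intro hi
      rw [pow_succ, pow_mul, ih (by omega), hstep i (by omega), if_neg (by omega)]
      simp
  have hlast : B 0 ^ p ^ r = B 0 - f := by
    obtain ⟨s, rfl⟩ := Nat.exists_eq_add_of_le' hr
    rw [pow_succ, pow_mul, hind s (by omega), hstep s (by omega), if_pos rfl]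
    have : B (s + 1) = B 0 := by
      simp only [hB]
      apply Finset.sum_congr rfl
      intro a _
      rw [← hF, ← map_pow, FiniteField.pow_card]; simp
    rw [this]; simp; ring
  refine ⟨-B 0, ?_⟩
  have h0 : (-B 0) ^ p ^ r = - (B 0 ^ p ^ r) := by
    have := sub_pow_char_pow (R := L) (p := p) (n := r) 0 (B 0)
    rw [zero_sub, zero_pow (pow_ne_zero _ hp.out.ne_zero), zero_sub] at this
    exact this
  rw [h0, hlast]; ring

theorem clear_den {L : Type} [Field L] (u g A B : L) (hg : g ≠ 0) (hB : B ≠ 0) (n : ℕ)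
    (h : u / g = (A / B) ^ (n + 1) - A / B) : u * B ^ (n + 1) = g * (A ^ (n + 1) - A * B ^ n) := by
  rw [div_eq_iff hg] at h
  have h2 : A / B * B ^ (n + 1) = A * B ^ n := by
    rw [pow_succ]; field_simp
  have h3 : (A / B) ^ (n + 1) * B ^ (n + 1) = A ^ (n + 1) := by
    rw [← mul_pow, div_mul_cancel₀ _ hB]
  rw [h]
  linear_combination g * h3 - g * h2

theorem descend {K : Type} [Field K] (p r : ℕ) [hp : Fact p.Prime] [CharP K p] (hr : 1 ≤ r)
    (g g₁ g₂ u : K[X]) (hg0 : g ≠ 0)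
    (hfact : g = g₁ ^ p ^ r * g₂)
    (hqfree : ¬ ∃ w : K[X], 0 < w.natDegree ∧ w ^ p ^ r ∣ g₂) (hug : u.degree < g.degree)
    (b : RatFunc K)
    (hb : (algebraMap K[X] (RatFunc K) u) / (algebraMap K[X] (RatFunc K) g) = b ^ p ^ r - b) :
    ∃ v : K[X], v.degree < g₁.degree ∧
      (algebraMap K[X] (RatFunc K) u) / (algebraMap K[X] (RatFunc K) g) =
      ((algebraMap K[X] (RatFunc K) v) / (algebraMap K[X] (RatFunc K) g₁)) ^ p ^ r -
       (algebraMap K[X] (RatFunc K) v) / (algebraMap K[X] (RatFunc K) g₁) := by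
  classical
  have hchar : CharP (RatFunc K) p := charP_of_injective_algebraMap (algebraMap K (RatFunc K)).injective p
  have hinj : ∀ a : K[X], a ≠ 0 → algebraMap K[X] (RatFunc K) a ≠ 0 := by
    intro a ha; exact RatFunc.algebraMap_ne_zero ha
  have hq1 : 1 < p ^ r := Nat.one_lt_pow (by omega) hp.out.one_lt
  set q := p ^ r with hq
  obtain ⟨q', hq'⟩ := Nat.exists_eq_add_of_le' hq1.le
  have hg10 : g₁ ≠ 0 := by
    rintro rfl
    apply hg0; rw [hfact, zero_pow (by omega), zero_mul]
  have hg20 : g₂ ≠ 0 := by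
    rintro rfl
    apply hg0; rw [hfact, mul_zero]
  set A := b.num with hA
  set B := b.denom with hBdef
  have hB0 : B ≠ 0 := b.denom_ne_zero
  have hAB : IsCoprime A B := b.isCoprime_num_denom
  have hbAB : algebraMap K[X] (RatFunc K) A / algebraMap K[X] (RatFunc K) B = b := b.num_div_denom
  have hpoly : u * B ^ q = g * (A ^ q - A * B ^ q') := by
    apply RatFunc.algebraMap_injective K
    have h1 := hinj B hB0
    have h2 := hinj g hg0
    rw [← hbAB] at hb
    simp only [map_mul, map_sub, map_pow]
    rw [hq'] at hb ⊢
    exact clear_den _ _ _ _ h2 h1 _ hb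
  have hBq : B ^ q ∣ g := by
    have h1 : IsCoprime (B ^ q) (A ^ q - A * B ^ q') := by
      apply IsCoprime.pow_left
      have hq'0 : q' ≠ 0 := by omega
      obtain ⟨q'', rfl⟩ := Nat.exists_eq_succ_of_ne_zero hq'0
      have : A ^ q - A * B ^ (q''.succ) = A ^ q + B * (-(A * B ^ q'')) := by
        rw [pow_succ]; ring
      rw [this]
      exact IsCoprime.add_mul_left_right (hAB.symm.pow_right) _
    exact h1.dvd_of_dvd_mul_right ⟨u, by rw [← hpoly]; ring⟩
  have hBg1 : B ∣ g₁ := by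
    obtain ⟨D, B', g1', hD⟩ : ∃ D B' g1' : K[X], B = D * B' ∧ g₁ = D * g1' ∧ IsCoprime B' g1' ∧ D ≠ 0 := by
      obtain ⟨B', hB'⟩ := EuclideanDomain.gcd_dvd_left B g₁
      obtain ⟨g1', hg1'⟩ := EuclideanDomain.gcd_dvd_right B g₁
      have hgne : EuclideanDomain.gcd B g₁ ≠ 0 := by
        intro h; rw [EuclideanDomain.gcd_eq_zero_iff] at h; exact hB0 h.1
      refine ⟨_, B', g1', hB', hg1', ?_, hgne⟩
      refine ⟨EuclideanDomain.gcdA B g₁, EuclideanDomain.gcdB B g₁, ?_⟩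
      have := EuclideanDomain.gcd_eq_gcd_ab B g₁
      apply mul_left_cancel₀ hgne
      linear_combination -this - EuclideanDomain.gcdA B g₁ * hB' - EuclideanDomain.gcdB B g₁ * hg1'
    obtain ⟨h1, h2, h3, h4⟩ := hD
    have h5 : B' ^ q ∣ g₂ := by
      have : D ^ q * B' ^ q ∣ D ^ q * (g1' ^ q * g₂) := by
        have e1 : D ^ q * B' ^ q = B ^ q := by rw [h1, mul_pow]
        have e2 : D ^ q * (g1' ^ q * g₂) = g := by rw [hfact, h2, mul_pow]; ring
        rw [e1, e2]; exact hBq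
      have := (mul_dvd_mul_iff_left (pow_ne_zero q h4)).1 this
      exact (h3.pow (m := q) (n := q)).dvd_of_dvd_mul_left this
    have h6 : B'.natDegree = 0 := by
      by_contra h
      exact hqfree ⟨B', Nat.pos_of_ne_zero h, h5⟩
    have h7 : IsUnit B' := by
      rw [isUnit_iff_degree_eq_zero]
      have : B' ≠ 0 := by rintro rfl; exact hB0 (by rw [h1, mul_zero])
      rw [degree_eq_natDegree this, h6]; rfl
    rw [h1, h2]
    exact mul_dvd_mul_left D h7.dvd
  obtain ⟨E, hE⟩ := hBg1
  have hE0 : E ≠ 0 := by rintro rfl; exact hg10 (by rw [hE, mul_zero])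
  set V := A * E with hV
  have hbV : b = algebraMap K[X] (RatFunc K) V / algebraMap K[X] (RatFunc K) g₁ := by
    rw [← hbAB, hV, hE, map_mul, map_mul, mul_div_mul_right _ _ (hinj E hE0)]
  set v := V % g₁ with hv
  set E1 := V / g₁ with hE1
  have hdm : g₁ * E1 + v = V := EuclideanDomain.div_add_mod V g₁
  have hvd : v.degree < g₁.degree := EuclideanDomain.mod_lt V hg10
  have hu : u = g₂ * (V ^ q - V * g₁ ^ q') := by
    have h1 := hinj g₁ hg10
    have h2 := hinj g hg0
    rw [hbV, hq'] at hb
    have h3 := clear_den _ _ _ _ h2 h1 _ hb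
    have h4 : u * g₁ ^ (q' + 1) = g * (V ^ (q' + 1) - V * g₁ ^ q') := by
      apply RatFunc.algebraMap_injective K
      simp only [map_mul, map_sub, map_pow]
      exact h3
    rw [← hq', hfact] at h4
    apply mul_right_cancel₀ (pow_ne_zero q hg10)
    rw [h4]; ring
  have hW : (V ^ q - V * g₁ ^ q').degree < (g₁ ^ q).degree := by
    rw [hu, hfact, mul_comm (g₁ ^ q), degree_mul, degree_mul] at hug
    exact lt_of_add_lt_add_left hug
  have hvW : (v ^ q - v * g₁ ^ q').degree < (g₁ ^ q).degree := by
    rcases eq_or_ne v 0 with h | h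
    · rw [h, zero_pow (by omega), zero_mul, sub_zero, degree_zero, bot_lt_iff_ne_bot]
      exact fun h => pow_ne_zero q hg10 (degree_eq_bot.1 h)
    · have hnd := natDegree_lt_natDegree h hvd
      refine lt_of_le_of_lt (degree_sub_le _ _) (max_lt ?_ ?_)
      · apply degree_lt_degree
        rw [natDegree_pow, natDegree_pow]
        exact Nat.mul_lt_mul_of_pos_left hnd (by omega)
      · apply degree_lt_degree
        rw [natDegree_mul h (pow_ne_zero _ hg10), natDegree_pow, natDegree_pow, hq']
        nlinarith
  have hEE : E1 ^ q - E1 = 0 := by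
    by_contra hne
    have e : g₁ ^ q * (E1 ^ q - E1) = (V ^ q - V * g₁ ^ q') - (v ^ q - v * g₁ ^ q') := by
      have hVq : V ^ q = g₁ ^ q * E1 ^ q + v ^ q := by
        rw [← hdm, hq, add_pow_char_pow, mul_pow]
      rw [hVq, ← hdm, hq']
      ring
    have h1 : (g₁ ^ q * (E1 ^ q - E1)).degree < (g₁ ^ q).degree := by
      rw [e]
      exact lt_of_le_of_lt (degree_sub_le _ _) (max_lt hW hvW)
    exact absurd (degree_le_mul_left (g₁ ^ q) hne) (not_le.2 h1)
  refine ⟨v, hvd, ?_⟩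
  have hbv : b = algebraMap K[X] (RatFunc K) E1 + algebraMap K[X] (RatFunc K) v / algebraMap K[X] (RatFunc K) g₁ := by
    rw [hbV, ← hdm, map_add, map_mul]
    have h1 := hinj g₁ hg10
    field_simp
  have hE1' := congrArg (algebraMap K[X] (RatFunc K)) hEE
  rw [map_sub, map_pow, map_zero] at hE1'
  rw [hb, hbv, hq, add_pow_char_pow, ← hq]
  linear_combination hE1'

theorem rad_degree {K : Type} [Field K] [Fintype K] [DecidableEq K] (g : K[X]) (hg : 0 < g.natDegree) (hnozero : ∀ x : K, g.eval x ≠ 0) :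
    2 ≤ (UniqueFactorizationMonoid.radical g).natDegree ∧ (UniqueFactorizationMonoid.radical g).natDegree ≤
      {x : AlgebraicClosure K | Polynomial.aeval x g = 0}.ncard := by
  classical
  have hg0 : g ≠ 0 := by rintro rfl; simp at hg
  have hR0 : UniqueFactorizationMonoid.radical g ≠ 0 := UniqueFactorizationMonoid.radical_ne_zero
  set R := UniqueFactorizationMonoid.radical g with hR
  have hRg : R ∣ g := UniqueFactorizationMonoid.radical_dvd_self
  constructor
  · obtain ⟨P, hP, hPg⟩ := exists_irreducible_of_natDegree_pos hg
    have hPR : P ∣ R := (UniqueFactorizationMonoid.dvd_radical_iff_of_irreducible hP hg0).2 hPg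
    have h1 := natDegree_le_of_dvd hPR hR0
    have h2 := hP.natDegree_pos
    have h3 : P.natDegree ≠ 1 := by
      intro h
      obtain ⟨x, hx⟩ := exists_root_of_degree_eq_one (p := P) (by rw [degree_eq_natDegree hP.ne_zero, h]; rfl)
      apply hnozero x
      exact (hx.dvd hPg)
    omega
  · have hsep : R.Separable := PerfectField.separable_iff_squarefree.2 UniqueFactorizationMonoid.squarefree_radical
    have hsep' : (R.map (algebraMap K (AlgebraicClosure K))).Separable := hsep.map
    have e1 : R.natDegree = (R.map (algebraMap K (AlgebraicClosure K))).roots.toFinset.card := by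
      rw [Multiset.toFinset_card_of_nodup (nodup_roots hsep'), ← natDegree_map (algebraMap K (AlgebraicClosure K))]
      exact (IsAlgClosed.splits _).natDegree_eq_card_roots
    rw [e1, ← Set.ncard_coe_finset]
    have hset : {x : AlgebraicClosure K | Polynomial.aeval x g = 0} = ((g.map (algebraMap K (AlgebraicClosure K))).roots.toFinset : Set (AlgebraicClosure K)) := by
      ext x
      simp [hg0]
    apply Set.ncard_le_ncard
    · intro x hx
      simp only [Finset.mem_coe, Multiset.mem_toFinset] at hx
      rw [mem_roots (Polynomial.map_ne_zero hR0), IsRoot.def, eval_map_algebraMap] at hx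
      obtain ⟨t, ht⟩ := hRg
      simp [ht, hx]
    · rw [hset]; exact Finset.finite_toSet _
end last

/-- (`K = E` for the Goppa-type divisor `G = (g)₀ − P_∞`.) Under the
point-count condition `(deg g + 2s − 2)·√(q^m) < q^m + 1`, every `u` with `deg u < deg g`
and `Tr(u(x)/g(x)) = 0` for all `x ∈ 𝔽_{q^m}` satisfies `u/g = (v/g₁)^q − v/g₁` for some
`v` with `deg v < deg g₁`. -/
theorem stmt_14 (p r m : ℕ) (hp : p.Prime) (hr : 1 ≤ r) (hm : 2 ≤ m)
    (F K : Type) [Field F] [Field K] [Algebra F K] [Fintype F] [Fintype K]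
    (hF : Fintype.card F = p ^ r) (hK : Fintype.card K = (p ^ r) ^ m)
    (g g₁ g₂ : K[X]) (hg : 0 < g.natDegree)
    (hnozero : ∀ x : K, g.eval x ≠ 0)
    (s : ℕ) (hs : s = {x : AlgebraicClosure K | Polynomial.aeval x g = 0}.ncard)
    (hfact : g = g₁ ^ p ^ r * g₂)
    (hqfree : ¬ ∃ w : K[X], 0 < w.natDegree ∧ w ^ p ^ r ∣ g₂)
    (hbound : ((g.natDegree : ℝ) + 2 * s - 2) * Real.sqrt (((p : ℝ) ^ r) ^ m)
      < ((p : ℝ) ^ r) ^ m + 1) :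
    ∀ u : K[X], u.degree < g.degree →
      (∀ x : K, Algebra.trace F K (u.eval x / g.eval x) = 0) →
      ∃ v : K[X], v.degree < g₁.degree ∧
        (u : RatFunc K) / (g : RatFunc K) =
          ((v : RatFunc K) / (g₁ : RatFunc K)) ^ p ^ r -
            (v : RatFunc K) / (g₁ : RatFunc K) := by
  classical
  intro u hug htr
  have hpf : Fact p.Prime := ⟨hp⟩
  have hg0 : g ≠ 0 := by rintro rfl; simp at hg
  have hQ : Fintype.card K = p ^ (r * m) := by rw [hK, pow_mul]
  have hcK : CharP K p := charP_of_card_eq_prime_pow hQ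
  have hchar : CharP (RatFunc K) p := charP_of_injective_algebraMap (algebraMap K (RatFunc K)).injective p
  have hfr : Module.finrank F K = m := by
    have h1 := Module.card_eq_pow_finrank (K := F) (V := K)
    rw [hK, hF] at h1
    exact (Nat.pow_right_injective (Nat.one_lt_pow (by omega) hp.one_lt) h1).symm
  obtain ⟨hρ2, hρs⟩ := rad_degree g hg hnozero
  rw [← hs] at hρs
  set R := UniqueFactorizationMonoid.radical g with hR
  have hR0 : R ≠ 0 := UniqueFactorizationMonoid.radical_ne_zero
  have hb : ((g.natDegree + R.natDegree - 1 : ℕ) : ℝ) * Real.sqrt (Fintype.card K) < Fintype.card K := by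
    have hQr : (Fintype.card K : ℝ) = ((p : ℝ) ^ r) ^ m := by exact_mod_cast hK
    rw [← hQr] at hbound
    have h1 : 1 ≤ Real.sqrt (Fintype.card K) := by
      rw [Real.one_le_sqrt]; exact_mod_cast Fintype.card_pos
    have h2 : (2 : ℝ) ≤ R.natDegree := by exact_mod_cast hρ2
    have h3 : (R.natDegree : ℝ) ≤ s := by exact_mod_cast hρs
    rw [Nat.cast_sub (by omega)]
    push_cast
    nlinarith
  have hmain : ∀ a : Fˣ, ∃ h : RatFunc K, ((algebraMap K (RatFunc K)).comp (algebraMap F K)) a *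
      (algebraMap K[X] (RatFunc K) u / algebraMap K[X] (RatFunc K) g) = h ^ p - h := by
    intro a
    have ha0 : algebraMap F K a ≠ 0 := by simp
    obtain ⟨h, hh⟩ := artin p (r * m) hQ (by nlinarith) R hR0 g.natDegree (C (algebraMap F K a) * u) g rfl
      dvd_rfl hnozero (by rwa [degree_C_mul ha0]) hb (by
        intro x
        rw [eval_mul, eval_C, mul_div_assoc]
        exact trace_conv p r m F K hF hfr a _ (htr x))
    refine ⟨h, ?_⟩
    rw [← hh, map_mul, mul_div_assoc]
    rfl
  obtain ⟨b, hb'⟩ := combine p r hr F (RatFunc K) _ hF _ hmain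
  exact descend p r hr g g₁ g₂ u hg0 hfact hqfree hug b hb'
end
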